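/- For each N ≥ 1, let T_N be a strictly upper triangular random matrix with law GT(N). Suppose M assigns to every n ≥ 1 and every 2n-tuple (k₁,ℓ₁,…,k_n,ℓ_n) of natural numbers a complex number M(k₁,ℓ₁,…,k_n,ℓ_n) such that E[tr_N((T_N*)^{k₁}·T_N^{ℓ₁}·⋯·(T_N*)^{k_n}·T_N^{ℓ_n})] → M(k₁,ℓ₁,…,k_n,ℓ_n) as N → ∞. Then for every n ≥ 1 and all strictly positive k₁,…,k_n,ℓ₁,…,ℓ_n with m := k₁+⋯+k_n = ℓ₁+⋯+ℓ_n, the following recursion holds: M(k₁,ℓ₁,…,k_n,ℓ_n) = (1/(m+1))·Σ_{r=1}^{n} Σ_{1≤j(1)<⋯<j(r)≤n} [ M(k₁,ℓ₁,…,k_{j(1)−1},ℓ_{j(1)−1}, k_{j(1)}−1, ℓ_{j(r)}−1, k_{j(r)+1},ℓ_{j(r)+1},…,k_n,ℓ_n) · ∏_{i=1}^{r−1} M(ℓ_{j(i)}−1, k_{j(i)+1}, ℓ_{j(i)+1},…,k_{j(i+1)−1},ℓ_{j(i+1)−1}, k_{j(i+1)}−1) ]. -/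

import Mathlib

open MeasureTheory ProbabilityTheory Matrix
open scoped ENNReal NNReal Classical

/-- The complex Gaussian measure `N_ℂ(0,v)`: the pushforward of `N(0,v/2) × N(0,v/2)` under
`(x,y) ↦ x + iy`. -/
noncomputable def complexGaussian (v : ℝ≥0) : Measure ℂ :=
  ((gaussianReal 0 (v / 2)).prod (gaussianReal 0 (v / 2))).map
    fun p => (p.1 : ℂ) + (p.2 : ℂ) * Complex.I

/-- The law `GT(n)` of a strictly upper triangular `n×n` random matrix with i.i.d. complex
Gaussian `N_ℂ(0,1/n)` entries above the diagonal (and zeros elsewhere). -/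
noncomputable def GTlaw (n : ℕ) : Measure (Fin n → Fin n → ℂ) :=
  Measure.pi fun i => Measure.pi fun j =>
    if (i : ℕ) < (j : ℕ) then complexGaussian ((n : ℝ≥0))⁻¹ else Measure.dirac 0

/-- The alternating word `A^{e₁} B^{e₂} A^{e₃} B^{e₄} ⋯` determined by a list `e` of
exponents (read alternately as exponents of `A` and of `B`). -/
def altWord {R : Type*} [Monoid R] (A B : R) : List ℕ → R
  | [] => 1
  | [a] => A ^ a
  | a :: b :: rest => A ^ a * B ^ b * altWord A B rest

/-- The interleaved exponent list `[k₁, ℓ₁, k₂, ℓ₂, …, k_n, ℓ_n]`. -/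
def blocksList (n : ℕ) (k l : Fin n → ℕ) : List ℕ :=
  (List.ofFn fun i : Fin n => [k i, l i]).flatten

/-- The exponent list of `M(k₁,ℓ₁,…,k_{a−1},ℓ_{a−1}, k_a−1, ℓ_b−1, k_{b+1},ℓ_{b+1},…,k_n,ℓ_n)`. -/
def outerList (n : ℕ) (k l : Fin n → ℕ) (a b : Fin n) : List ℕ :=
  (((List.finRange n).filter fun i => decide (i < a)).flatMap fun i => [k i, l i]) ++
    [k a - 1, l b - 1] ++
    (((List.finRange n).filter fun i => decide (b < i)).flatMap fun i => [k i, l i])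

/-- The exponent list of `M(ℓ_a−1, k_{a+1}, ℓ_{a+1}, …, k_{b−1}, ℓ_{b−1}, k_b−1)`. -/
def segmentList (n : ℕ) (k l : Fin n → ℕ) (a b : Fin n) : List ℕ :=
  [l a - 1] ++
    (((List.finRange n).filter fun i => decide (a < i ∧ i < b)).flatMap fun i => [k i, l i]) ++
    [k b - 1]

/-- evaluation of a word -/
noncomputable def ev {N : ℕ} (S : Matrix (Fin N) (Fin N) ℂ) (w : List Bool) :
    Matrix (Fin N) (Fin N) ℂ :=
  (w.map fun b => cond b S Sᴴ).prod

/-- bordered matrix -/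
def asm {N : ℕ} (v : Fin N → ℂ) (S : Fin N → Fin N → ℂ) : Fin (N+1) → Fin (N+1) → ℂ :=
  Fin.cons (Fin.cons 0 v) (fun i => Fin.cons 0 (S i))

/-- quadratic form -/
noncomputable def qf {N : ℕ} (v : Fin N → ℂ) (B : Matrix (Fin N) (Fin N) ℂ) : ℂ :=
  v ⬝ᵥ (B *ᵥ star v)

lemma ev_append {N : ℕ} (S : Matrix (Fin N) (Fin N) ℂ) (x y : List Bool) :
    ev S (x ++ y) = ev S x * ev S y := by simp [ev]

lemma ev_nil {N : ℕ} (S : Matrix (Fin N) (Fin N) ℂ) : ev S [] = 1 := by simp [ev]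

lemma ev_repT {N : ℕ} (S : Matrix (Fin N) (Fin N) ℂ) (a : ℕ) :
    ev S (List.replicate a true) = S ^ a := by simp [ev]

lemma ev_repF {N : ℕ} (S : Matrix (Fin N) (Fin N) ℂ) (a : ℕ) :
    ev S (List.replicate a false) = Sᴴ ^ a := by simp [ev]

lemma trace_ev_comm {N : ℕ} (S : Matrix (Fin N) (Fin N) ℂ) (x y : List Bool) :
    (ev S (x ++ y)).trace = (ev S (y ++ x)).trace := by
  rw [ev_append, ev_append, Matrix.trace_mul_comm]

lemma asm_mul {N : ℕ} (v v' : Fin N → ℂ) (S S' : Matrix (Fin N) (Fin N) ℂ) :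
    (Matrix.of (asm v S)) * (Matrix.of (asm v' S')) = Matrix.of (asm (v ᵥ* S') (S * S')) := by
  ext i j
  refine Fin.cases ?_ (fun i => ?_) i <;> refine Fin.cases ?_ (fun j => ?_) j <;>
    simp [asm, Matrix.mul_apply, Fin.sum_univ_succ, Matrix.vecMul, dotProduct]

lemma asm_pow {N : ℕ} (v : Fin N → ℂ) (S : Matrix (Fin N) (Fin N) ℂ) (l : ℕ) :
    (Matrix.of (asm v S)) ^ (l+1) = Matrix.of (asm (v ᵥ* S ^ l) (S ^ (l+1))) := by
  induction l with
  | zero => simp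
  | succ l ih => rw [pow_succ', ih, asm_mul, ← pow_succ']

/-- lower block embedding -/
def emb {N : ℕ} (X : Matrix (Fin N) (Fin N) ℂ) : Matrix (Fin (N+1)) (Fin (N+1)) ℂ :=
  Matrix.of (asm 0 X)

lemma emb_mul {N : ℕ} (X Y : Matrix (Fin N) (Fin N) ℂ) : emb X * emb Y = emb (X * Y) := by
  simp [emb, asm_mul]

lemma trace_emb {N : ℕ} (X : Matrix (Fin N) (Fin N) ℂ) : (emb X).trace = X.trace := by
  simp [emb, Matrix.trace, Fin.sum_univ_succ, asm]

lemma trace_asm {N : ℕ} (v) (X : Matrix (Fin N) (Fin N) ℂ) :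
    (Matrix.of (asm v X)).trace = X.trace := by
  simp [Matrix.trace, Fin.sum_univ_succ, asm]

lemma asm_star_mul {N : ℕ} (v v' : Fin N → ℂ) (S S' : Matrix (Fin N) (Fin N) ℂ) :
    (Matrix.of (asm v S))ᴴ * (Matrix.of (asm v' S')) =
      emb (Sᴴ * S' + vecMulVec (star v) v') := by
  ext i j
  refine Fin.cases ?_ (fun i => ?_) i <;> refine Fin.cases ?_ (fun j => ?_) j <;>
    simp [asm, emb, Matrix.mul_apply, Fin.sum_univ_succ, vecMulVec, add_comm]

lemma block_asm {N : ℕ} (v : Fin N → ℂ) (S : Matrix (Fin N) (Fin N) ℂ) (k l : ℕ)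
    (hk : 1 ≤ k) (hl : 1 ≤ l) :
    ev (Matrix.of (asm v S)) (List.replicate k false ++ List.replicate l true) =
      emb (ev S (List.replicate k false ++ List.replicate l true) +
        vecMulVec (ev S (List.replicate (k-1) false) *ᵥ star v)
          (v ᵥ* ev S (List.replicate (l-1) true))) := by
  obtain ⟨k, rfl⟩ := Nat.exists_eq_add_of_le' hk
  obtain ⟨l, rfl⟩ := Nat.exists_eq_add_of_le' hl
  simp only [ev_append, ev_repT, ev_repF, Nat.add_sub_cancel]
  rw [← Matrix.conjTranspose_pow, asm_pow, asm_pow, asm_star_mul, Matrix.star_vecMul,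
    Matrix.conjTranspose_pow, Matrix.conjTranspose_pow]

/-- partial products -/
def PP {N : ℕ} (P : ℕ → Matrix (Fin N) (Fin N) ℂ) (a b : ℕ) : Matrix (Fin N) (Fin N) ℂ :=
  ((List.range' a (b - a)).map P).prod

lemma PP_self {N : ℕ} (P : ℕ → Matrix (Fin N) (Fin N) ℂ) (a : ℕ) : PP P a a = 1 := by simp [PP]

lemma PP_succ {N : ℕ} (P : ℕ → Matrix (Fin N) (Fin N) ℂ) (a b : ℕ) (h : a ≤ b) :
    PP P a (b+1) = PP P a b * P b := by
  have : b + 1 - a = (b - a) + 1 := by omega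
  rw [PP, this, List.range'_concat]
  simp [PP, Nat.add_sub_cancel' h]

lemma expand_X {N : ℕ} (P : ℕ → Matrix (Fin N) (Fin N) ℂ) (ket bra : ℕ → Fin N → ℂ) (b : ℕ) :
    PP (fun i => P i + vecMulVec (ket i) (bra i)) 0 b = PP P 0 b +
      ∑ c ∈ Finset.range b, PP (fun i => P i + vecMulVec (ket i) (bra i)) 0 c *
        vecMulVec (ket c) (bra c) * PP P (c+1) b := by
  induction b with
  | zero => simp [PP_self]
  | succ b ih =>
    rw [PP_succ _ _ _ (Nat.zero_le _), mul_add, Finset.sum_range_succ, PP_self, mul_one, ← add_assoc]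
    congr 1
    conv_lhs => rw [ih]
    rw [add_mul, ← PP_succ _ _ _ (Nat.zero_le _), Finset.sum_mul]
    congr 1
    refine Finset.sum_congr rfl fun c hc => ?_
    rw [PP_succ _ _ _ (by simp at hc; omega), mul_assoc, mul_assoc]

lemma expand_y {N : ℕ} (P : ℕ → Matrix (Fin N) (Fin N) ℂ) (ket bra : ℕ → Fin N → ℂ) (b : ℕ) :
    PP (fun i => P i + vecMulVec (ket i) (bra i)) 0 b *ᵥ ket b = PP P 0 b *ᵥ ket b +
      ∑ c ∈ Finset.range b, (bra c ⬝ᵥ (PP P (c+1) b *ᵥ ket b)) •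
        (PP (fun i => P i + vecMulVec (ket i) (bra i)) 0 c *ᵥ ket c) := by
  rw [expand_X, Matrix.add_mulVec, Matrix.sum_mulVec]
  congr 1
  refine Finset.sum_congr rfl fun c hc => ?_
  rw [← Matrix.mulVec_mulVec, ← Matrix.mulVec_mulVec, Matrix.vecMulVec_mulVec,
    Matrix.mulVec_smul]
  simp

lemma expand_tr {N : ℕ} (P : ℕ → Matrix (Fin N) (Fin N) ℂ) (ket bra : ℕ → Fin N → ℂ) (b : ℕ) :
    (PP (fun i => P i + vecMulVec (ket i) (bra i)) 0 b).trace = (PP P 0 b).trace +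
      ∑ c ∈ Finset.range b, bra c ⬝ᵥ (PP P (c+1) b *ᵥ
        (PP (fun i => P i + vecMulVec (ket i) (bra i)) 0 c *ᵥ ket c)) := by
  conv_lhs => rw [expand_X]
  rw [Matrix.trace_add, Matrix.trace_sum]
  congr 1
  refine Finset.sum_congr rfl fun c hc => ?_
  rw [Matrix.mul_vecMulVec, Matrix.vecMulVec_mul, Matrix.trace_vecMulVec, Matrix.dotProduct_mulVec,
    dotProduct_comm]

/-- chain sums -/
noncomputable def Zc {n : ℕ} {V : Type*} [AddCommGroup V] [Module ℂ V] (seg : Fin n → Fin n → ℂ)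
    (base : Fin n → V) (r : ℕ) (c : Fin n) : V :=
  ∑ j : Fin (r+1) → Fin n, if StrictMono j ∧ j (Fin.last r) = c then
    (∏ i : Fin r, seg (j i.castSucc) (j i.succ)) • base (j 0) else 0

lemma strictMono_snoc {n r : ℕ} (j : Fin (r+1) → Fin n) (c : Fin n) :
    StrictMono (Fin.snoc j c : Fin (r+2) → Fin n) ↔ StrictMono j ∧ j (Fin.last r) < c := by
  rw [Fin.strictMono_iff_lt_succ, Fin.strictMono_iff_lt_succ, Fin.forall_fin_succ']
  simp only [Fin.succ_last, Fin.snoc_last, Fin.snoc_castSucc, Fin.succ_castSucc]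

lemma Zc_zero {n : ℕ} {V : Type*} [AddCommGroup V] [Module ℂ V] (seg : Fin n → Fin n → ℂ)
    (base : Fin n → V) (c : Fin n) : Zc seg base 0 c = base c := by
  unfold Zc
  rw [← (Equiv.funUnique (Fin 1) (Fin n)).symm.sum_comp]
  simp [Subsingleton.strictMono]

lemma Zc_succ {n : ℕ} {V : Type*} [AddCommGroup V] [Module ℂ V] (seg : Fin n → Fin n → ℂ)
    (base : Fin n → V) (r : ℕ) (c : Fin n) : Zc seg base (r+1) c =
      ∑ d : Fin n, if d < c then seg d c • Zc seg base r d else 0 := by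
  unfold Zc
  rw [← (Fin.snocEquiv (fun _ : Fin (r+2) => Fin n)).sum_comp, Fintype.sum_prod_type]
  have hs : ∀ (d : Fin n) (j : Fin (r+1) → Fin n),
    (Fin.snocEquiv (fun _ : Fin (r+2) => Fin n)) (d, j) = Fin.snoc j d := fun _ _ => rfl
  simp only [hs]
  rw [Finset.sum_eq_single c]
  · rw [← Finset.sum_filter (fun d => d < c)]
    simp_rw [Finset.smul_sum]
    rw [Finset.sum_comm]
    refine Finset.sum_congr rfl fun j _ => ?_
    simp only [strictMono_snoc, Fin.snoc_last, and_true]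
    rw [Finset.sum_filter, Finset.sum_eq_single (j (Fin.last r))]
    · by_cases h1 : StrictMono j <;> by_cases h2 : j (Fin.last r) < c <;> simp [h1, h2]
      rw [Fin.prod_univ_castSucc]
      simp only [Fin.succ_last, Fin.snoc_last, Fin.snoc_castSucc, Fin.succ_castSucc, smul_smul]
      rw [mul_comm]
    · intro d _ hd
      simp [Ne.symm hd]
    · simp
  · intro d _ hd
    refine Finset.sum_eq_zero fun j _ => ?_
    simp [hd]
  · simp

lemma Zc_ge {n : ℕ} {V : Type*} [AddCommGroup V] [Module ℂ V] (seg : Fin n → Fin n → ℂ)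
    (base : Fin n → V) (r : ℕ) (hr : n ≤ r) (c : Fin n) : Zc seg base r c = 0 := by
  refine Finset.sum_eq_zero fun j _ => ?_
  rw [if_neg]
  rintro ⟨h, -⟩
  have := Fintype.card_le_of_injective j h.injective
  simp at this
  omega

lemma chain_sol {n : ℕ} {V : Type*} [AddCommGroup V] [Module ℂ V] (seg : Fin n → Fin n → ℂ)
    (base y : Fin n → V)
    (h : ∀ c, y c = base c + ∑ d : Fin n, if d < c then seg d c • y d else 0) (c : Fin n) :
    y c = ∑ r : Fin n, Zc seg base r c := by
  rw [Fin.sum_univ_eq_sum_range (fun r => Zc seg base r c)]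
  induction c using WellFoundedLT.induction with
  | _ c ih =>
  have e : ∑ r ∈ Finset.range n, Zc seg base r c = ∑ r ∈ Finset.range (n+1), Zc seg base r c := by
    rw [Finset.sum_range_succ, Zc_ge _ _ _ le_rfl, add_zero]
  rw [e, Finset.sum_range_succ', Zc_zero, h c, add_comm]
  congr 1
  simp_rw [Zc_succ]
  rw [Finset.sum_comm]
  refine Finset.sum_congr rfl fun d _ => ?_
  by_cases hd : d < c
  · simp [hd, ih d hd, Finset.smul_sum]
  · simp [hd]

lemma chain_tr {n : ℕ} {V : Type*} [AddCommGroup V] [Module ℂ V] (seg : Fin n → Fin n → ℂ)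
    (base y : Fin n → V)
    (h : ∀ c, y c = base c + ∑ d : Fin n, if d < c then seg d c • y d else 0)
    (ψ : Fin n → V →ₗ[ℂ] ℂ) :
    ∑ c, ψ c (y c) = ∑ r : Fin n, ∑ j : Fin ((r:ℕ)+1) → Fin n, if StrictMono j then
      ψ (j (Fin.last r)) (base (j 0)) * ∏ i : Fin (r:ℕ), seg (j i.castSucc) (j i.succ) else 0 := by
  simp_rw [chain_sol seg base y h, map_sum]
  rw [Finset.sum_comm]
  refine Finset.sum_congr rfl fun r _ => ?_
  simp_rw [Zc, map_sum]
  rw [Finset.sum_comm]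
  refine Finset.sum_congr rfl fun j _ => ?_
  rw [Finset.sum_eq_single (j (Fin.last r))]
  · by_cases h1 : StrictMono j <;> simp [h1, mul_comm]
  · intro d _ hd
    simp [Ne.symm hd]
  · simp

/-- weight of a family of words -/
def wt (us : List (List Bool)) : ℕ := (us.map fun u => u.length + 2).sum

/-- expansions of the trace of a word in a bordered matrix -/
structure WExp (w : List Bool) where
  ι : Type
  fi : Fintype ι
  us : ι → List (List Bool)
  wt_eq : ∀ i, wt (us i) = w.length
  tr_eq : ∀ (N : ℕ) (v : Fin N → ℂ) (S : Matrix (Fin N) (Fin N) ℂ),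
    (ev (Matrix.of (asm v S)) w).trace = (ev S w).trace +
      ∑ i, ((us i).map fun u => qf v (ev S u)).prod

/-- block -/
def blk (K L : ℕ → ℕ) (i : ℕ) : List Bool := List.replicate (K i) false ++ List.replicate (L i) true

/-- block word -/
def bw (K L : ℕ → ℕ) (a b : ℕ) : List Bool := (List.range' a (b - a)).flatMap (blk K L)

/-- outer word -/
def outerW (K L : ℕ → ℕ) (n a b : ℕ) : List Bool :=
  List.replicate (L b - 1) true ++ (bw K L (b+1) n ++ (bw K L 0 a ++ List.replicate (K a - 1) false))

/-- segment word -/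
def segW (K L : ℕ → ℕ) (a b : ℕ) : List Bool :=
  List.replicate (L a - 1) true ++ (bw K L (a+1) b ++ List.replicate (K b - 1) false)

lemma ev_flatMap {N : ℕ} {α : Type*} (S : Matrix (Fin N) (Fin N) ℂ) (f : α → List Bool) (x : List α) :
    ev S (x.flatMap f) = (x.map fun i => ev S (f i)).prod := by
  induction x with
  | nil => simp [ev_nil]
  | cons a x ih => simp [List.flatMap_cons, ev_append, ih]

lemma ev_bw {N : ℕ} (S : Matrix (Fin N) (Fin N) ℂ) (K L : ℕ → ℕ) (a b : ℕ) :
    ev S (bw K L a b) = PP (fun i => ev S (blk K L i)) a b := ev_flatMap _ _ _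

lemma emb_PP {N : ℕ} (X : ℕ → Matrix (Fin N) (Fin N) ℂ) (n : ℕ) :
    PP (fun i => emb (X i)) 0 (n+1) = emb (PP X 0 (n+1)) := by
  induction n with
  | zero => simp [PP]
  | succ n ih => rw [PP_succ _ _ _ (Nat.zero_le _), ih, PP_succ _ _ (n+1) (Nat.zero_le _), emb_mul]

lemma block_identity {N n : ℕ} (hn : 1 ≤ n) (K L : ℕ → ℕ) (hK : ∀ i, 1 ≤ K i) (hL : ∀ i, 1 ≤ L i)
    (v : Fin N → ℂ) (S : Matrix (Fin N) (Fin N) ℂ) :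
    (ev (Matrix.of (asm v S)) (bw K L 0 n)).trace = (ev S (bw K L 0 n)).trace +
      ∑ r : Fin n, ∑ j : Fin ((r:ℕ)+1) → Fin n, if StrictMono j then
        qf v (ev S (outerW K L n (j 0) (j (Fin.last r)))) *
          ∏ i : Fin (r:ℕ), qf v (ev S (segW K L (j i.castSucc) (j i.succ))) else 0 := by
  set P : ℕ → Matrix (Fin N) (Fin N) ℂ := fun i => ev S (blk K L i) with hP
  set ket : ℕ → Fin N → ℂ := fun i => ev S (List.replicate (K i-1) false) *ᵥ star v with hket
  set bra : ℕ → Fin N → ℂ := fun i => v ᵥ* ev S (List.replicate (L i-1) true) with hbra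
  have h1 : (ev (Matrix.of (asm v S)) (bw K L 0 n)) =
      emb (PP (fun i => P i + vecMulVec (ket i) (bra i)) 0 n) := by
    obtain ⟨n, rfl⟩ := Nat.exists_eq_add_of_le' hn
    rw [ev_bw, ← emb_PP]
    congr 1
    funext i
    exact block_asm v S _ _ (hK i) (hL i)
  rw [h1, trace_emb, expand_tr, ev_bw]
  congr 1
  rw [← Fin.sum_univ_eq_sum_range (fun c => bra c ⬝ᵥ (PP P (c+1) n *ᵥ
        (PP (fun i => P i + vecMulVec (ket i) (bra i)) 0 c *ᵥ ket c)))]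
  have := chain_tr (n := n) (fun a b => bra a ⬝ᵥ (PP P (a+1) b *ᵥ ket b))
    (fun c => PP P 0 c *ᵥ ket c)
    (fun c => PP (fun i => P i + vecMulVec (ket i) (bra i)) 0 c *ᵥ ket c) (by
      intro c
      refine (expand_y P ket bra c).trans ?_
      congr 1
      rw [← Finset.sum_filter]
      refine Finset.sum_bij' (fun d hd => ⟨d, (Finset.mem_range.1 hd).trans c.2⟩) (fun d _ => d.1)
        ?_ ?_ ?_ ?_ ?_
      · intro d hd; simp at hd ⊢; exact hd
      · intro d hd; simp at hd ⊢; exact hd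
      · intro d hd; rfl
      · intro d hd; rfl
      · intro d hd; rfl)
    (fun c => dotProductBilin ℂ ℂ (bra c) ∘ₗ (Matrix.mulVecLin (PP P (c+1) n)))
  refine this.trans ?_
  refine Finset.sum_congr rfl fun r _ => Finset.sum_congr rfl fun j _ => ?_
  have q1 : ∀ a b : ℕ, qf v (ev S (outerW K L n a b)) =
      bra b ⬝ᵥ (PP P (b+1) n *ᵥ (PP P 0 a *ᵥ ket a)) := by
    intro a b
    simp only [qf, outerW, ev_append, ev_bw, ← Matrix.mulVec_mulVec, hbra, hket]
    rw [← Matrix.dotProduct_mulVec]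
  have q2 : ∀ a b : ℕ, qf v (ev S (segW K L a b)) =
      bra a ⬝ᵥ (PP P (a+1) b *ᵥ ket b) := by
    intro a b
    simp only [qf, segW, ev_append, ev_bw, ← Matrix.mulVec_mulVec, hbra, hket]
    rw [← Matrix.dotProduct_mulVec]
  simp only [q1, q2]
  rfl

lemma bw_length (K L : ℕ → ℕ) (a b : ℕ) (h : a ≤ b) : ((bw K L a b).length : ℤ) =
    (∑ i ∈ Finset.range b, ((K i : ℤ) + L i)) - ∑ i ∈ Finset.range a, ((K i : ℤ) + L i) := by
  obtain ⟨d, rfl⟩ := Nat.exists_eq_add_of_le h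
  induction d with
  | zero => simp [bw]
  | succ d ih =>
    have h2 := ih (by omega)
    have : bw K L a (a + (d+1)) = bw K L a (a+d) ++ blk K L (a+d) := by
      simp [bw, List.range'_concat]
    rw [this, ← add_assoc, Finset.sum_range_succ, List.length_append]
    push_cast
    rw [h2]
    simp [blk]
    ring

lemma tele (r : ℕ) (h : Fin (r+1) → ℤ) :
    ∑ i : Fin r, (h i.succ - h i.castSucc) = h (Fin.last r) - h 0 := by
  induction r with
  | zero => simp
  | succ r ih =>
    rw [Fin.sum_univ_castSucc]
    have := ih (fun i => h i.castSucc)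
    simp only [Fin.succ_castSucc, Fin.succ_last, Fin.castSucc_zero] at this ⊢
    rw [this]
    ring

lemma chain_wt {n : ℕ} (K L : ℕ → ℕ) (hK : ∀ i, 1 ≤ K i) (hL : ∀ i, 1 ≤ L i) (r : ℕ)
    (j : Fin (r+1) → Fin n) (hj : StrictMono j) :
    wt (outerW K L n (j 0) (j (Fin.last r)) ::
      List.ofFn fun i : Fin r => segW K L (j i.castSucc) (j i.succ)) = (bw K L 0 n).length := by
  zify
  set g : ℕ → ℤ := fun a => (∑ i ∈ Finset.range a, ((K i : ℤ) + L i)) with hg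
  have gs : ∀ a, g (a+1) = g a + (K a + L a) := fun a => Finset.sum_range_succ _ _
  have hbw : ∀ a b, a ≤ b → ((bw K L a b).length : ℤ) = g b - g a := bw_length K L
  have h0 : ((outerW K L n (j 0) (j (Fin.last r))).length : ℤ) + 2
      = (g (j 0) + K (j 0)) + g n - (g (j (Fin.last r)) + K (j (Fin.last r))) := by
    have := hK (j 0)
    have := hL (j (Fin.last r))
    simp only [outerW, List.length_append, List.length_replicate]
    push_cast [Nat.cast_sub (hK (j 0)), Nat.cast_sub (hL (j (Fin.last r)))]
    rw [hbw _ _ (by omega), hbw _ _ (by omega), gs]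
    simp [hg]; ring
  have h1 : ∀ i : Fin r, ((segW K L (j i.castSucc) (j i.succ)).length : ℤ) + 2
      = (g (j i.succ) + K (j i.succ)) - (g (j i.castSucc) + K (j i.castSucc)) := by
    intro i
    have hlt : j i.castSucc < j i.succ := hj (Fin.castSucc_lt_succ)
    simp only [segW, List.length_append, List.length_replicate]
    push_cast [Nat.cast_sub (hK (j i.succ)), Nat.cast_sub (hL (j i.castSucc))]
    rw [hbw _ _ (by exact hlt), gs]
    ring
  have h2 := tele r (fun i => g (j i) + K (j i))
  rw [wt, List.map_cons, List.sum_cons, List.map_ofFn, List.sum_ofFn]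
  push_cast
  simp only [Function.comp_apply]
  push_cast
  rw [h0, Finset.sum_congr rfl fun i _ => h1 i, h2, hbw _ _ (by omega)]
  simp [hg]

lemma sum_chain {n : ℕ} {f : (r : Fin n) → (Fin ((r:ℕ)+1) → Fin n) → ℂ} :
    ∑ x : (Σ r : Fin n, {j : Fin ((r:ℕ)+1) → Fin n // StrictMono j}), f x.1 x.2.1 =
    ∑ r : Fin n, ∑ j : Fin ((r:ℕ)+1) → Fin n, if StrictMono j then f r j else 0 := by
  rw [Fintype.sum_sigma]
  refine Finset.sum_congr rfl fun r _ => ?_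
  rw [← Finset.sum_filter]
  symm
  exact Finset.sum_subtype _ (by simp) _

/-- the expansion of a block word -/
noncomputable def blockExp (n : ℕ) (hn : 1 ≤ n) (K L : ℕ → ℕ) (hK : ∀ i, 1 ≤ K i)
    (hL : ∀ i, 1 ≤ L i) : WExp (bw K L 0 n) where
  ι := Σ r : Fin n, {j : Fin ((r:ℕ)+1) → Fin n // StrictMono j}
  fi := inferInstance
  us := fun x => outerW K L n (x.2.1 0) (x.2.1 (Fin.last x.1)) ::
      List.ofFn fun i : Fin (x.1:ℕ) => segW K L (x.2.1 i.castSucc) (x.2.1 i.succ)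
  wt_eq := fun x => chain_wt K L hK hL _ x.2.1 x.2.2
  tr_eq := by
    intro N v S
    rw [block_identity hn K L hK hL v S, ← sum_chain]
    congr 1
    refine Finset.sum_congr rfl fun x _ => ?_
    simp [List.prod_ofFn, List.map_ofFn]

/-- expansion is invariant under rotation -/
noncomputable def WExp.rot {x y : List Bool} (E : WExp (x ++ y)) : WExp (y ++ x) where
  ι := E.ι
  fi := E.fi
  us := E.us
  wt_eq := fun i => by rw [E.wt_eq]; simp [add_comm]
  tr_eq := fun N v S => by rw [trace_ev_comm, E.tr_eq, trace_ev_comm S]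

lemma exp_nil : Nonempty (WExp []) :=
  ⟨{ ι := Unit, fi := inferInstance, us := fun _ => [], wt_eq := fun _ => rfl,
     tr_eq := fun N v S => by simp [ev_nil, Matrix.trace_one] }⟩

lemma exp_T (a : ℕ) : Nonempty (WExp (List.replicate a true)) := by
  cases a with
  | zero => exact exp_nil
  | succ a =>
    refine ⟨⟨Empty, inferInstance, fun _ => [], fun x => Empty.elim x, fun N v S => ?_⟩⟩
    simp [ev_repT, asm_pow, trace_asm]

lemma exp_F (a : ℕ) : Nonempty (WExp (List.replicate a false)) := by
  cases a with
  | zero => exact exp_nil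
  | succ a =>
    refine ⟨⟨Empty, inferInstance, fun _ => [], fun x => Empty.elim x, fun N v S => ?_⟩⟩
    simp [ev_repF, ← Matrix.conjTranspose_pow, asm_pow, Matrix.trace_conjTranspose, trace_asm]

/-- word of list of pairs -/
def pw (bs : List (ℕ × ℕ)) : List Bool :=
  bs.flatMap fun p => List.replicate (p.1+1) false ++ List.replicate (p.2+1) true

lemma exp_pw (bs : List (ℕ × ℕ)) : Nonempty (WExp (pw bs)) := by
  by_cases h : bs = []
  · subst h; exact exp_nil
  have hl : 1 ≤ bs.length := by
    rw [Nat.one_le_iff_ne_zero]; simpa using h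
  have e := blockExp bs.length hl (fun i => (bs.getD i (0,0)).1 + 1)
    (fun i => (bs.getD i (0,0)).2 + 1) (by simp) (by simp)
  have : bw (fun i => (bs.getD i (0,0)).1 + 1) (fun i => (bs.getD i (0,0)).2 + 1) 0 bs.length = pw bs := by
    have h1 : bs = (List.range' 0 bs.length).map (fun i => bs.getD i (0,0)) := by
      apply List.ext_getElem
      · simp
      · intro i h1 h2
        simp [List.getElem?_eq_getElem h1]
    conv_rhs => rw [pw, h1, List.flatMap_map]
    rfl
  rw [this] at e
  exact ⟨e⟩

lemma word_form (w : List Bool) : ∃ a bs c, w = List.replicate a true ++ (pw bs ++ List.replicate c false) := by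
  induction w with
  | nil => exact ⟨0, [], 0, rfl⟩
  | cons b w ih =>
    obtain ⟨a, bs, c, rfl⟩ := ih
    cases b
    · cases a with
      | succ a => exact ⟨0, (0, a) :: bs, c, by simp [pw]⟩
      | zero =>
        cases bs with
        | nil => exact ⟨0, [], c+1, by simp [pw, List.replicate_succ]⟩
        | cons p bs => exact ⟨0, (p.1+1, p.2) :: bs, c, by simp [pw, List.replicate_succ]⟩
    · exact ⟨a+1, bs, c, by simp [List.replicate_succ]⟩

lemma exp_all (w : List Bool) : Nonempty (WExp w) := by
  obtain ⟨a, bs, c, rfl⟩ := word_form w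
  rw [← List.append_assoc]
  suffices h : Nonempty (WExp (List.replicate c false ++ (List.replicate a true ++ pw bs))) from
    ⟨h.some.rot⟩
  cases c with
  | zero =>
    simp only [List.replicate_zero, List.nil_append]
    suffices h : Nonempty (WExp (pw bs ++ List.replicate a true)) from ⟨h.some.rot⟩
    rcases List.eq_nil_or_concat bs with rfl | ⟨bs, p, rfl⟩
    · simpa [pw] using exp_T a
    · convert! exp_pw (bs ++ [(p.1, p.2 + a)]) using 2
      simp [pw]
      omega
  | succ c =>
    cases a with
    | succ a =>
      convert! exp_pw ((c, a) :: bs) using 2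
      simp [pw]
    | zero =>
      cases bs with
      | nil => simpa [pw] using exp_F (c+1)
      | cons p bs =>
        convert! exp_pw ((p.1 + (c + 1), p.2) :: bs) using 2
        simp [pw]
        rw [← List.append_assoc, ← List.replicate_add]
        congr 1; congr 1; omega

/-- all moments finite -/
def AllLp {α : Type*} [MeasurableSpace α] (f : α → ℂ) (μ : Measure α) : Prop :=
  ∀ p : ℝ≥0∞, p ≠ ∞ → MemLp f p μ

section AllLp
variable {α β : Type*} [MeasurableSpace α] [MeasurableSpace β] {μ : Measure α} {ν : Measure β}

lemma AllLp.mul {f g : α → ℂ} (hf : AllLp f μ) (hg : AllLp g μ) :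
    AllLp (fun x => f x * g x) μ := by
  intro p hp
  have h2 : (2 : ℝ≥0∞) * p ≠ ∞ := ENNReal.mul_ne_top (by simp) hp
  have : ENNReal.HolderTriple (2 * p) (2 * p) p := ⟨by
    rw [ENNReal.mul_inv (by simp) (by simp), ← add_mul, ENNReal.inv_two_add_inv_two, one_mul]⟩
  exact (hg _ h2).mul (hf _ h2)

lemma AllLp.add {f g : α → ℂ} (hf : AllLp f μ) (hg : AllLp g μ) :
    AllLp (fun x => f x + g x) μ := fun p hp => (hf p hp).add (hg p hp)

lemma AllLp.star {f : α → ℂ} (hf : AllLp f μ) :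
    AllLp (fun x => star (f x)) μ := fun p hp => (hf p hp).star

lemma AllLp.const [IsFiniteMeasure μ] (c : ℂ) : AllLp (fun _ : α => c) μ :=
  fun _ _ => memLp_const c

lemma AllLp.sum {ι : Type*} (s : Finset ι) {f : ι → α → ℂ} (hf : ∀ i, AllLp (f i) μ) :
    AllLp (fun x => ∑ i ∈ s, f i x) μ := fun p hp => memLp_finsetSum s fun i _ => hf i p hp

lemma AllLp.pow [IsFiniteMeasure μ] {f : α → ℂ} (hf : AllLp f μ) (n : ℕ) :
    AllLp (fun x => f x ^ n) μ := by
  induction n with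
  | zero => simpa using AllLp.const 1
  | succ n ih => simpa [pow_succ] using ih.mul hf

lemma AllLp.list_prod [IsFiniteMeasure μ] {ι : Type*} (l : List ι) {f : ι → α → ℂ}
    (hf : ∀ i, AllLp (f i) μ) : AllLp (fun x => (l.map fun i => f i x).prod) μ := by
  induction l with
  | nil => simpa using AllLp.const 1
  | cons a l ih => simpa using (hf a).mul ih

lemma AllLp.prod [IsFiniteMeasure μ] {ι : Type*} (s : Finset ι) {f : ι → α → ℂ}
    (hf : ∀ i, AllLp (f i) μ) : AllLp (fun x => ∏ i ∈ s, f i x) μ := by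
  induction s using Finset.induction_on with
  | empty => simpa using AllLp.const 1
  | insert a s h ih => simpa [Finset.prod_insert h] using (hf a).mul ih

lemma AllLp.integrable {f : α → ℂ} (hf : AllLp f μ) : Integrable f μ :=
  memLp_one_iff_integrable.1 (hf 1 (by simp))

lemma AllLp.comp {f : β → ℂ} (hf : AllLp f ν) {g : α → β} (hg : MeasurePreserving g μ ν) :
    AllLp (fun x => f (g x)) μ := fun p hp => (hf p hp).comp_measurePreserving hg

lemma AllLp.ev [IsFiniteMeasure μ] {N : ℕ} {S : α → Matrix (Fin N) (Fin N) ℂ}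
    (hS : ∀ i j, AllLp (fun x => S x i j) μ) (w : List Bool) (i j : Fin N) :
    AllLp (fun x => ev (S x) w i j) μ := by
  induction w generalizing i j with
  | nil => simpa [ev_nil] using AllLp.const _
  | cons b w ih =>
    have e : ∀ x, _root_.ev (S x) (b :: w) = cond b (S x) (S x)ᴴ * _root_.ev (S x) w := by
      intro x; simp [_root_.ev]
    simp only [e, Matrix.mul_apply]
    refine AllLp.sum _ fun k => AllLp.mul ?_ (ih k j)
    cases b
    · exact (hS k i).star
    · exact hS i k

lemma AllLp.tr [IsFiniteMeasure μ] {N : ℕ} {S : α → Matrix (Fin N) (Fin N) ℂ}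
    (hS : ∀ i j, AllLp (fun x => S x i j) μ) (w : List Bool) :
    AllLp (fun x => (_root_.ev (S x) w).trace) μ :=
  AllLp.sum _ fun i => AllLp.ev hS w i i

lemma AllLp.qf [IsFiniteMeasure μ] {N : ℕ} {S : α → Matrix (Fin N) (Fin N) ℂ}
    {v : α → Fin N → ℂ} (hv : ∀ i, AllLp (fun x => v x i) μ)
    (hS : ∀ i j, AllLp (fun x => S x i j) μ) (w : List Bool) :
    AllLp (fun x => _root_.qf (v x) (_root_.ev (S x) w)) μ := by
  simp only [_root_.qf, dotProduct, mulVec, Pi.star_apply]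
  exact AllLp.sum _ fun i => (hv i).mul (AllLp.sum _ fun j => (AllLp.ev hS w i j).mul (hv j).star)

end AllLp

lemma stein {v : ℝ≥0} (hv : v ≠ 0) {f f' : ℝ → ℂ} (hd : ∀ x, HasDerivAt f (f' x) x)
    (hf : AllLp f (gaussianReal 0 v)) (hf' : AllLp f' (gaussianReal 0 v)) :
    ∫ x, (x : ℂ) * f x ∂(gaussianReal 0 v) = (v : ℂ) * ∫ x, f' x ∂(gaussianReal 0 v) := by
  have hv' : (v : ℝ) ≠ 0 := by exact_mod_cast hv
  have hid : AllLp (fun x : ℝ => (x : ℂ)) (gaussianReal 0 v) := fun p hp =>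
    (memLp_id_gaussianReal' p hp).ofReal
  have key : ∀ g : ℝ → ℂ, AllLp g (gaussianReal 0 v) →
      Integrable (fun x => gaussianPDFReal 0 v x • g x) := by
    intro g hg
    have := hg.integrable
    rw [gaussianReal_of_var_ne_zero _ hv] at this
    rw [integrable_withDensity_iff_integrable_smul' (measurable_gaussianPDF _ _)
      (by simp [gaussianPDF])] at this
    simpa [gaussianPDF, ENNReal.toReal_ofReal (gaussianPDFReal_nonneg _ _ _)] using this
  have hp : ∀ x, HasDerivAt (gaussianPDFReal 0 v) (-(x / v) * gaussianPDFReal 0 v x) x := by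
    intro x
    rw [gaussianPDFReal_def]
    have h1 : HasDerivAt (fun x : ℝ => -(x - 0)^2 / (2 * (v:ℝ))) (-(x / v)) x := by
      have := ((((hasDerivAt_id x).sub_const 0).pow 2).neg.div_const (2 * (v:ℝ)))
      convert! this using 1
      simp; field_simp
    have := (h1.exp).const_mul ((√(2 * Real.pi * v))⁻¹)
    convert! this using 1
    simp; ring
  have h0 := integral_eq_zero_of_hasDerivAt_of_integrable
    (f := fun x => gaussianPDFReal 0 v x • f x)
    (f' := fun x => gaussianPDFReal 0 v x • f' x - (v : ℂ)⁻¹ * (gaussianPDFReal 0 v x • (x * f x)))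
    (fun x => by
      convert! (hp x).smul (hd x) using 1
      simp only [Complex.real_smul]
      push_cast
      field_simp
      ring)
    ((key f' hf').sub ((key _ (hid.mul hf)).const_mul _)) (key f hf)
  rw [integral_sub (key f' hf') ((key _ (hid.mul hf)).const_mul _), integral_const_mul] at h0
  rw [integral_gaussianReal_eq_integral_smul hv, integral_gaussianReal_eq_integral_smul hv]
  have hvc : (v : ℂ) ≠ 0 := by exact_mod_cast hv
  rw [sub_eq_zero] at h0
  rw [h0]
  field_simp

/-- standard complex Gaussian -/
noncomputable abbrev CG : Measure ℂ := complexGaussian 1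

/-- the real Gaussian with variance one half -/
noncomputable abbrev gH : Measure ℝ := gaussianReal 0 (1/2)

lemma meas_c : Measurable (fun p : ℝ × ℝ => (p.1 : ℂ) + (p.2 : ℂ) * Complex.I) := by fun_prop

lemma CG_mp : MeasurePreserving (fun p : ℝ × ℝ => (p.1 : ℂ) + (p.2 : ℂ) * Complex.I)
    (gH.prod gH) CG := ⟨meas_c, rfl⟩

instance cg_prob (v : ℝ≥0) : IsProbabilityMeasure (complexGaussian v) :=
  Measure.isProbabilityMeasure_map meas_c.aemeasurable

lemma gH_id : AllLp (fun x : ℝ => (x : ℂ)) gH := fun p hp => (memLp_id_gaussianReal' p hp).ofReal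

lemma gH_fst : AllLp (fun x : ℝ × ℝ => (x.1 : ℂ)) (gH.prod gH) :=
  gH_id.comp measurePreserving_fst
lemma gH_snd : AllLp (fun x : ℝ × ℝ => (x.2 : ℂ)) (gH.prod gH) :=
  gH_id.comp measurePreserving_snd

lemma CG_id : AllLp (fun z : ℂ => z) CG := by
  intro p hp
  rw [CG, complexGaussian, memLp_map_measure_iff measurable_id'.aestronglyMeasurable meas_c.aemeasurable]
  exact (gH_fst.add (gH_snd.mul (AllLp.const Complex.I))) p hp

lemma CG_stein (a b : ℕ) :
    ∫ z, z * (z ^ a * (star z) ^ b) ∂CG = b * ∫ z, z ^ a * (star z) ^ (b-1) ∂CG := by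
  have hI : ∀ (a b : ℕ), AllLp (fun z : ℂ => z ^ a * (star z) ^ b) CG := fun a b =>
    (CG_id.pow a).mul (CG_id.star.pow b)
  have hP : ∀ (a b : ℕ), AllLp (fun p : ℝ × ℝ => ((p.1 : ℂ) + p.2 * Complex.I) ^ a *
      ((p.1 : ℂ) - p.2 * Complex.I) ^ b) (gH.prod gH) := fun a b => by
    have := (hI a b).comp CG_mp
    simpa [sub_eq_add_neg] using this
  have tr : ∀ f : ℂ → ℂ, Measurable f →
      ∫ z, f z ∂CG = ∫ p, f ((p.1 : ℂ) + p.2 * Complex.I) ∂(gH.prod gH) := fun f hf =>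
    integral_map meas_c.aemeasurable hf.aestronglyMeasurable
  rw [tr _ (by fun_prop), tr _ (by fun_prop)]
  have hs : ∀ p : ℝ × ℝ, star ((p.1 : ℂ) + p.2 * Complex.I) = (p.1 : ℂ) - p.2 * Complex.I := by
    intro p; simp [sub_eq_add_neg]
  simp only [hs, add_mul]
  have i1 := gH_fst.mul (hP a b)
  have i2 := (gH_snd.mul (AllLp.const (μ := gH.prod gH) Complex.I)).mul (hP a b)
  rw [integral_add i1.integrable i2.integrable]
  -- derivative pieces
  set A : ℝ × ℝ → ℂ := fun p => a * (((p.1 : ℂ) + p.2 * Complex.I) ^ (a-1) *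
      ((p.1 : ℂ) - p.2 * Complex.I) ^ b) with hA
  set B : ℝ × ℝ → ℂ := fun p => b * (((p.1 : ℂ) + p.2 * Complex.I) ^ a *
      ((p.1 : ℂ) - p.2 * Complex.I) ^ (b-1)) with hB
  have iA : AllLp A (gH.prod gH) := (AllLp.const _).mul (hP (a-1) b)
  have iB : AllLp B (gH.prod gH) := (AllLp.const _).mul (hP a (b-1))
  have poly1 : ∀ (c : ℂ) (y : ℂ) (n : ℕ), AllLp (fun x : ℝ => ((x : ℂ) + y) ^ n) gH := fun c y n =>
    (gH_id.add (AllLp.const y)).pow n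
  have aff : ∀ (c d : ℂ) (n : ℕ), AllLp (fun x : ℝ => (c * (x : ℂ) + d) ^ n) gH := fun c d n =>
    (((AllLp.const c).mul gH_id).add (AllLp.const d)).pow n
  have hx : ∫ p, (p.1 : ℂ) * (((p.1 : ℂ) + p.2 * Complex.I) ^ a *
      ((p.1 : ℂ) - p.2 * Complex.I) ^ b) ∂(gH.prod gH) = (1/2) * ∫ p, (A p + B p) ∂(gH.prod gH) := by
    rw [integral_prod_symm _ i1.integrable, integral_prod_symm _ (iA.add iB).integrable,
      ← integral_const_mul]
    congr 1
    funext y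
    have h1 : ∀ n, AllLp (fun x : ℝ => ((x : ℂ) + y * Complex.I) ^ n) gH := fun n => by
      simpa using aff 1 (y * Complex.I) n
    have h2 : ∀ n, AllLp (fun x : ℝ => ((x : ℂ) - y * Complex.I) ^ n) gH := fun n => by
      simpa [sub_eq_add_neg] using aff 1 (-(y * Complex.I)) n
    have := stein (v := 1/2) (by norm_num) (f := fun x : ℝ => ((x : ℂ) + y * Complex.I) ^ a *
      ((x : ℂ) - y * Complex.I) ^ b) (f' := fun x => A (x, y) + B (x, y)) (fun x => by
        have e1 := ((Complex.ofRealCLM.hasDerivAt (x := x)).add_const ((y : ℂ) * Complex.I)).pow a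
        have e2 := ((Complex.ofRealCLM.hasDerivAt (x := x)).sub_const ((y : ℂ) * Complex.I)).pow b
        convert! e1.mul e2 using 1
        simp [hA, hB]; ring) ((h1 a).mul (h2 b))
        (((AllLp.const _).mul ((h1 (a-1)).mul (h2 b))).add ((AllLp.const _).mul ((h1 a).mul (h2 (b-1)))))
    rw [this]; push_cast; rfl
  have hy : ∫ p, (p.2 : ℂ) * Complex.I * (((p.1 : ℂ) + p.2 * Complex.I) ^ a *
      ((p.1 : ℂ) - p.2 * Complex.I) ^ b) ∂(gH.prod gH) = (1/2) * ∫ p, (B p - A p) ∂(gH.prod gH) := by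
    rw [integral_prod _ i2.integrable, integral_prod (fun p => B p - A p)
      (iB.integrable.sub iA.integrable), ← integral_const_mul]
    congr 1
    funext x
    have h1 : ∀ n, AllLp (fun y : ℝ => ((x : ℂ) + y * Complex.I) ^ n) gH := fun n => by
      simpa [mul_comm, add_comm] using aff Complex.I x n
    have h2 : ∀ n, AllLp (fun y : ℝ => ((x : ℂ) - y * Complex.I) ^ n) gH := fun n => by
      simpa [sub_eq_add_neg, mul_comm, add_comm] using aff (-Complex.I) x n
    have := stein (v := 1/2) (by norm_num) (f := fun y : ℝ => Complex.I * (((x : ℂ) + y * Complex.I) ^ a *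
      ((x : ℂ) - y * Complex.I) ^ b)) (f' := fun y => B (x, y) + (-1) * A (x, y)) (fun y => by
        have e1 := (((Complex.ofRealCLM.hasDerivAt (x := y)).mul_const Complex.I).const_add (x:ℂ)).pow a
        have e2 := (((Complex.ofRealCLM.hasDerivAt (x := y)).mul_const Complex.I).const_sub (x:ℂ)).pow b
        convert! (e1.mul e2).const_mul Complex.I using 1
        simp [hA, hB]; ring_nf; simp; ring) ((AllLp.const _).mul ((h1 a).mul (h2 b)))
        (((AllLp.const _).mul ((h1 a).mul (h2 (b-1)))).add
          ((AllLp.const _).mul ((AllLp.const _).mul ((h1 (a-1)).mul (h2 b)))))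
    simp only [mul_assoc]
    rw [this]; push_cast
    simp only [neg_one_mul, ← sub_eq_add_neg]
  rw [hx, hy, integral_add iA.integrable iB.integrable, integral_sub iB.integrable iA.integrable]
  have : ∫ p, B p ∂(gH.prod gH) = b * ∫ (p : ℝ × ℝ), ((p.1 : ℂ) + p.2 * Complex.I) ^ a *
      ((p.1 : ℂ) - p.2 * Complex.I) ^ (b-1) ∂(gH.prod gH) := integral_const_mul _ _
  rw [← this]; ring

lemma CG_scale (c : ℝ≥0) : CG.map (fun z => (c : ℂ) * z) = complexGaussian (c^2) := by
  rw [CG, complexGaussian, Measure.map_map (by fun_prop) meas_c, complexGaussian]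
  have h : gaussianReal 0 (c^2/2) = (gaussianReal 0 (1/2)).map (fun x => (c:ℝ) * x) := by
    rw [gaussianReal_map_const_mul]
    congr 1
    · simp
    · ext; simp; ring
  rw [h, Measure.map_prod_map _ _ (by fun_prop) (by fun_prop), Measure.map_map meas_c (by fun_prop)]
  congr 1
  funext p
  simp; ring

lemma CG_conj : CG.map (fun z => star z) = CG := by
  rw [CG, complexGaussian, Measure.map_map (by fun_prop) meas_c]
  have h : gaussianReal 0 (1/2) = (gaussianReal 0 (1/2)).map (fun x => -x) := by
    rw [gaussianReal_map_neg]; simp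
  have h2 : (gH.prod gH) = (gH.prod gH).map (Prod.map id (fun x : ℝ => -x)) := by
    rw [← Measure.map_prod_map _ _ (by fun_prop) (by fun_prop), ← h, Measure.map_id]
  conv_rhs => rw [h2]
  rw [Measure.map_map meas_c (by fun_prop)]
  congr 1
  funext p
  simp

/-- entry laws -/
noncomputable def entL (i j : ℕ) : Measure ℂ := if i < j then CG else Measure.dirac 0

instance entL_prob (i j : ℕ) : IsProbabilityMeasure (entL i j) := by
  unfold entL; split_ifs <;> infer_instance

/-- unnormalised law -/
noncomputable def Qm (N : ℕ) : Measure (Fin N → Fin N → ℂ) :=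
  Measure.pi fun i => Measure.pi fun j => entL i j

instance Qm_prob (N : ℕ) : IsProbabilityMeasure (Qm N) := by unfold Qm; infer_instance

/-- law of the border -/
noncomputable def Vm (N : ℕ) : Measure (Fin N → ℂ) := Measure.pi fun _ => CG

instance Vm_prob (N : ℕ) : IsProbabilityMeasure (Vm N) := by unfold Vm; infer_instance

lemma entL_id (i j : ℕ) : AllLp (fun z : ℂ => z) (entL i j) := by
  unfold entL
  split_ifs
  · exact CG_id
  · intro p hp
    refine MemLp.of_bound (C := 0) measurable_id'.aestronglyMeasurable ?_
    simp [ae_dirac_eq]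

lemma Qm_coord {N : ℕ} (i j : Fin N) : AllLp (fun S : Fin N → Fin N → ℂ => S i j) (Qm N) := by
  have h1 : MeasurePreserving (fun S : Fin N → Fin N → ℂ => S i) (Qm N)
    (Measure.pi fun j : Fin N => entL i j) :=
    measurePreserving_eval (fun i : Fin N => Measure.pi fun j : Fin N => entL i j) i
  have h2 : MeasurePreserving (fun S : Fin N → ℂ => S j) (Measure.pi fun j : Fin N => entL i j)
    (entL i j) := measurePreserving_eval (fun j : Fin N => entL i j) j
  exact (entL_id i j).comp (h2.comp h1)

lemma Vm_coord {N : ℕ} (i : Fin N) : AllLp (fun v : Fin N → ℂ => v i) (Vm N) := by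
  have h2 : MeasurePreserving (fun S : Fin N → ℂ => S i) (Vm N) CG :=
    measurePreserving_eval (fun j : Fin N => CG) i
  exact CG_id.comp h2

lemma pi_cons {N : ℕ} {X : Type*} [MeasurableSpace X] (μ : Fin (N+1) → Measure X)
    [∀ i, IsProbabilityMeasure (μ i)] :
    ((μ 0).prod (Measure.pi fun i : Fin N => μ i.succ)).map
      (fun p => (Fin.cons p.1 p.2 : Fin (N+1) → X)) = Measure.pi μ := by
  have := (measurePreserving_piFinSuccAbove μ 0).symm.map_eq
  have e : (fun p : X × (Fin N → X) => (Fin.cons p.1 p.2 : Fin (N+1) → X)) =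
      ⇑(MeasurableEquiv.piFinSuccAbove (fun _ => X) 0).symm := by
    funext p
    exact (Fin.insertNth_zero (α := fun _ => X) p.1 p.2).symm
  rw [e]
  exact this

lemma meas_cons {N : ℕ} {X : Type*} [MeasurableSpace X] :
    Measurable (fun p : X × (Fin N → X) => (Fin.cons p.1 p.2 : Fin (N+1) → X)) := by
  rw [measurable_pi_iff]
  intro i
  refine Fin.cases ?_ (fun i => ?_) i
  · simpa using measurable_fst
  · simp only [Fin.cons_succ]
    exact (measurable_pi_apply i).comp measurable_snd

lemma meas_cons0 {N : ℕ} {X : Type*} [MeasurableSpace X] (c : X) :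
    Measurable (fun p : (Fin N → X) => (Fin.cons c p : Fin (N+1) → X)) :=
  meas_cons.comp (measurable_const.prodMk measurable_id)

lemma pi_cons0 {N : ℕ} (μ : Fin (N+1) → Measure ℂ)
    [∀ i, IsProbabilityMeasure (μ i)] (h : μ 0 = Measure.dirac 0) :
    (Measure.pi fun i : Fin N => μ i.succ).map
      (fun p => (Fin.cons 0 p : Fin (N+1) → ℂ)) = Measure.pi μ := by
  rw [← pi_cons μ, h, Measure.dirac_prod, Measure.map_map meas_cons (by fun_prop)]
  rfl

lemma Qm_succ (N : ℕ) : MeasurePreserving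
    (fun p : (Fin N → ℂ) × (Fin N → Fin N → ℂ) => asm p.1 p.2) ((Vm N).prod (Qm N)) (Qm (N+1)) := by
  have hm : Measurable (fun p : (Fin N → ℂ) × (Fin N → Fin N → ℂ) => asm p.1 p.2) := by
    unfold asm
    refine meas_cons.comp (((meas_cons0 _).comp measurable_fst).prodMk ?_)
    rw [measurable_pi_iff]
    exact fun i => (meas_cons0 _).comp ((measurable_pi_apply i).comp measurable_snd)
  refine ⟨hm, ?_⟩
  have h0 : (Measure.pi fun j : Fin (N+1) => entL (0 : Fin (N+1)) j) =
      (Vm N).map (fun p => (Fin.cons 0 p : Fin (N+1) → ℂ)) := by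
    rw [← pi_cons0 (fun j : Fin (N+1) => entL (0 : Fin (N+1)) j) (by simp [entL])]
    simp [entL, Vm]
  have h1 : ∀ i : Fin N, (Measure.pi fun j : Fin (N+1) => entL i.succ j) =
      (Measure.pi fun j : Fin N => entL i j).map (fun p => (Fin.cons 0 p : Fin (N+1) → ℂ)) := by
    intro i
    rw [← pi_cons0 (fun j : Fin (N+1) => entL i.succ j) (by simp [entL])]
    simp [entL]
  conv_rhs => rw [Qm, ← pi_cons, h0]
  simp only [h1]
  rw [← Measure.pi_map_pi (fun i => (meas_cons0 _).aemeasurable)]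
  rw [Measure.map_prod_map _ _ (meas_cons0 _) (by
    rw [measurable_pi_iff]
    exact fun i => (meas_cons0 _).comp (measurable_pi_apply i)), Measure.map_map meas_cons (by
    refine ((meas_cons0 _).comp measurable_fst).prodMk ?_
    rw [measurable_pi_iff]
    exact fun i => (meas_cons0 _).comp ((measurable_pi_apply i).comp measurable_snd))]
  rfl

lemma GT_scale (N : ℕ) (hN : 1 ≤ N) : MeasurePreserving
    (fun (S : Fin N → Fin N → ℂ) i j => ((√(N:ℝ) : ℝ) : ℂ)⁻¹ * S i j) (Qm N) (GTlaw N) := by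
  refine ⟨by fun_prop, ?_⟩
  have hN' : (N : ℝ≥0) ≠ 0 := by positivity
  have e : ∀ i j : Fin N, (if (i : ℕ) < (j : ℕ) then complexGaussian ((N : ℝ≥0))⁻¹ else Measure.dirac 0)
      = (entL i j).map (fun z => ((√(N:ℝ) : ℝ) : ℂ)⁻¹ * z) := by
    intro i j
    unfold entL
    split_ifs
    · have := CG_scale ((NNReal.sqrt N)⁻¹)
      rw [inv_pow, NNReal.sq_sqrt] at this
      rw [← this]
      simp
    · rw [Measure.map_dirac' (by fun_prop)]; simp
  unfold GTlaw
  simp only [e]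
  have h2 : ∀ i j : Fin N, IsProbabilityMeasure ((entL i j).map (fun z => ((√(N:ℝ) : ℝ) : ℂ)⁻¹ * z)) :=
    fun i j => Measure.isProbabilityMeasure_map (by fun_prop)
  have h1 : ∀ i : Fin N, (Measure.pi fun j : Fin N =>
      (entL i j).map (fun z => ((√(N:ℝ) : ℝ) : ℂ)⁻¹ * z)) =
      (Measure.pi fun j : Fin N => entL i j).map (fun x j => ((√(N:ℝ) : ℝ) : ℂ)⁻¹ * x j) := by
    intro i
    rw [Measure.pi_map_pi (fun j => by fun_prop)]
  simp only [h1]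
  have h3 : ∀ i : Fin N, IsProbabilityMeasure ((Measure.pi fun j : Fin N => entL i j).map
    (fun x j => ((√(N:ℝ) : ℝ) : ℂ)⁻¹ * x j)) :=
    fun i => Measure.isProbabilityMeasure_map (by fun_prop : Measurable _).aemeasurable
  rw [← Measure.pi_map_pi (fun j => (by fun_prop : Measurable _).aemeasurable)]
  rfl

lemma Qm_curry (N : ℕ) : (Measure.pi fun p : Fin N × Fin N => entL p.1 p.2).map
    (MeasurableEquiv.curry (Fin N) (Fin N) ℂ) = Qm N := by
  have := Measure.infinitePi_map_curry (fun i j : Fin N => entL i j)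
  simpa only [Measure.infinitePi_eq_pi, Qm] using this

/-- index flip -/
def flipE (N : ℕ) : Fin N × Fin N ≃ Fin N × Fin N where
  toFun p := (p.2.rev, p.1.rev)
  invFun p := (p.2.rev, p.1.rev)
  left_inv p := by simp
  right_inv p := by simp

lemma Qm_flip (N : ℕ) : MeasurePreserving
    (fun (S : Fin N → Fin N → ℂ) i j => star (S j.rev i.rev)) (Qm N) (Qm N) := by
  refine ⟨by fun_prop, ?_⟩
  have hm : Measurable (fun (S : Fin N × Fin N → ℂ) => fun p => star (S (flipE N p))) := by fun_prop
  have h1 : (Measure.pi fun p : Fin N × Fin N => entL p.1 p.2).map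
      (fun S p => star (S (flipE N p))) = Measure.pi fun p : Fin N × Fin N => entL p.1 p.2 := by
    have a1 : ∀ i j : ℕ, (entL i j).map (fun z => star z) = entL i j := by
      intro i j
      unfold entL
      split_ifs
      · exact CG_conj
      · rw [Measure.map_dirac' (by fun_prop)]; simp
    have a2 : ∀ p : Fin N × Fin N, entL (flipE N p).1 (flipE N p).2 = entL p.1 p.2 := by
      intro p
      simp only [entL, flipE, Equiv.coe_fn_mk, Fin.val_rev]
      congr 1
      rw [eq_iff_iff]; omega
    have a3 := (measurePreserving_piCongrLeft (α := fun _ : Fin N × Fin N => ℂ)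
      (fun p : Fin N × Fin N => entL p.1 p.2) (flipE N)).map_eq
    simp only [a2] at a3
    have hp : ∀ p : Fin N × Fin N, IsProbabilityMeasure ((entL p.1 p.2).map (fun z => star z)) :=
      fun p => by rw [a1]; infer_instance
    have a4 := Measure.pi_map_pi (μ := fun p : Fin N × Fin N => entL p.1 p.2)
      (f := fun _ z => star z) (fun p => by fun_prop)
    simp only [a1] at a4
    conv_rhs => rw [← a4, ← a3]
    rw [Measure.map_map (by fun_prop) (MeasurableEquiv.measurable _)]
    congr 1
    funext S p
    simp only [Function.comp_apply]
    congr 1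
    obtain ⟨q, rfl⟩ := (flipE N).surjective p
    exact (Equiv.piCongrLeft_apply_apply (fun _ => ℂ) (flipE N) S q).symm ▸ by simp [flipE]
  rw [← Qm_curry, Measure.map_map (by fun_prop) (MeasurableEquiv.measurable _)]
  conv_rhs => rw [← h1]
  rw [Measure.map_map (MeasurableEquiv.measurable _) hm]
  rfl

/-- evaluation point -/
noncomputable def evv {N : ℕ} (v : Fin N → ℂ) : Fin N ⊕ Fin N → ℂ := Sum.elim v (star v)

lemma evv_all {N : ℕ} (i : Fin N ⊕ Fin N) : AllLp (fun v : Fin N → ℂ => evv v i) (Vm N) := by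
  rcases i with a | a
  · exact Vm_coord a
  · exact (Vm_coord a).star

lemma eval_all {N : ℕ} (P : MvPolynomial (Fin N ⊕ Fin N) ℂ) :
    AllLp (fun v : Fin N → ℂ => MvPolynomial.eval (evv v) P) (Vm N) := by
  induction P using MvPolynomial.induction_on with
  | C a => simpa using AllLp.const a
  | add p q hp hq => simpa using hp.add hq
  | mul_X p i hp => simpa using hp.mul (evv_all i)

/-- moments -/
noncomputable def gm (a b : ℕ) : ℂ := ∫ z, z ^ a * (star z) ^ b ∂CG

lemma gm_succ (a b : ℕ) : gm (a+1) b = b * gm a (b-1) := by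
  unfold gm
  rw [← CG_stein]
  congr 1; funext z; ring

/-- expectation of polynomials -/
noncomputable def Ep {N : ℕ} (P : MvPolynomial (Fin N ⊕ Fin N) ℂ) : ℂ :=
  ∫ v, MvPolynomial.eval (evv v) P ∂(Vm N)

lemma Ep_add {N : ℕ} (P Q : MvPolynomial (Fin N ⊕ Fin N) ℂ) : Ep (P + Q) = Ep P + Ep Q := by
  unfold Ep
  simp only [map_add]
  exact integral_add (eval_all P).integrable (eval_all Q).integrable

lemma Ep_C {N : ℕ} (c : ℂ) (P : MvPolynomial (Fin N ⊕ Fin N) ℂ) :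
    Ep (MvPolynomial.C c * P) = c * Ep P := by
  unfold Ep
  simp only [map_mul, MvPolynomial.eval_C]
  exact integral_const_mul _ _

lemma Ep_zero {N : ℕ} : Ep (0 : MvPolynomial (Fin N ⊕ Fin N) ℂ) = 0 := by simp [Ep]

lemma Ep_sum {N : ℕ} {ι : Type*} (s : Finset ι) (f : ι → MvPolynomial (Fin N ⊕ Fin N) ℂ) :
    Ep (∑ i ∈ s, f i) = ∑ i ∈ s, Ep (f i) := by
  induction s using Finset.induction_on with
  | empty => simp [Ep_zero]
  | insert a s h ih => rw [Finset.sum_insert h, Finset.sum_insert h, Ep_add, ih]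

lemma Ep_monomial {N : ℕ} (s : Fin N ⊕ Fin N →₀ ℕ) (c : ℂ) :
    Ep (MvPolynomial.monomial s c) = c * ∏ k : Fin N, gm (s (Sum.inl k)) (s (Sum.inr k)) := by
  unfold Ep gm Vm
  simp only [MvPolynomial.eval_monomial]
  rw [integral_const_mul]
  congr 1
  rw [← integral_fintype_prod_eq_prod]
  congr 1; funext v
  rw [Finsupp.prod_fintype _ _ (by simp), Fintype.prod_sum_type, ← Finset.prod_mul_distrib]
  simp [evv]

lemma Ep_ibp {N : ℕ} (a : Fin N) (P : MvPolynomial (Fin N ⊕ Fin N) ℂ) :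
    Ep (MvPolynomial.X (Sum.inl a) * P) = Ep (MvPolynomial.pderiv (Sum.inr a) P) := by
  induction P using MvPolynomial.induction_on' with
  | add p q hp hq => rw [mul_add, Ep_add, hp, hq, map_add, Ep_add]
  | monomial s c =>
    rw [MvPolynomial.pderiv_monomial, MvPolynomial.X, MvPolynomial.monomial_mul, one_mul,
      Ep_monomial, Ep_monomial, mul_assoc]
    congr 1
    rw [← Finset.mul_prod_erase _ _ (Finset.mem_univ a), ← Finset.mul_prod_erase _ (fun k : Fin N =>
      gm ((s - Finsupp.single (Sum.inr a) 1 : Fin N ⊕ Fin N →₀ ℕ) (Sum.inl k))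
        ((s - Finsupp.single (Sum.inr a) 1 : Fin N ⊕ Fin N →₀ ℕ) (Sum.inr k)))
      (Finset.mem_univ a), ← mul_assoc]
    congr 1
    · simp only [Finsupp.coe_add, Finsupp.coe_tsub, Pi.add_apply, Pi.sub_apply, Finsupp.single_eq_same]
      rw [add_comm 1, gm_succ]
      simp
    · refine Finset.prod_congr rfl fun k hk => ?_
      have hk' : k ≠ a := by simpa using hk
      simp [hk', hk'.symm]

/-- linear factor -/
noncomputable def Lf {N : ℕ} (B : Matrix (Fin N) (Fin N) ℂ) (a : Fin N) :
    MvPolynomial (Fin N ⊕ Fin N) ℂ := ∑ b, MvPolynomial.C (B a b) * MvPolynomial.X (Sum.inr b)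

/-- quadratic form polynomial -/
noncomputable def Qp {N : ℕ} (B : Matrix (Fin N) (Fin N) ℂ) :
    MvPolynomial (Fin N ⊕ Fin N) ℂ := ∑ a, MvPolynomial.X (Sum.inl a) * Lf B a

lemma eval_Qp {N : ℕ} (B : Matrix (Fin N) (Fin N) ℂ) (v : Fin N → ℂ) :
    MvPolynomial.eval (evv v) (Qp B) = qf v B := by
  simp [Qp, Lf, qf, evv, dotProduct, mulVec]

/-- the derivation -/
noncomputable def Db {N : ℕ} (B : Matrix (Fin N) (Fin N) ℂ) (P : MvPolynomial (Fin N ⊕ Fin N) ℂ) :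
    MvPolynomial (Fin N ⊕ Fin N) ℂ := ∑ a, Lf B a * MvPolynomial.pderiv (Sum.inr a) P

lemma pd_Lp {N : ℕ} (B : Matrix (Fin N) (Fin N) ℂ) (a c : Fin N) :
    MvPolynomial.pderiv (Sum.inr a) (Lf B c) = MvPolynomial.C (B c a) := by
  simp only [Lf, map_sum, Derivation.leibniz, MvPolynomial.pderiv_C, MvPolynomial.pderiv_X,
    smul_eq_mul, mul_zero, add_zero]
  rw [Finset.sum_eq_single a]
  · simp
  · intro b _ hb
    simp [Pi.single_apply, hb]
  · simp

lemma Db_mul {N : ℕ} (B : Matrix (Fin N) (Fin N) ℂ) (P Q : MvPolynomial (Fin N ⊕ Fin N) ℂ) :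
    Db B (P * Q) = Db B P * Q + P * Db B Q := by
  simp only [Db, Derivation.leibniz, smul_eq_mul, Finset.sum_mul, Finset.mul_sum,
    ← Finset.sum_add_distrib]
  refine Finset.sum_congr rfl fun a _ => by ring

lemma Db_Qp {N : ℕ} (B B' : Matrix (Fin N) (Fin N) ℂ) : Db B (Qp B') = Qp (B' * B) := by
  have h : ∀ a : Fin N, MvPolynomial.pderiv (Sum.inr a) (Qp B') =
      ∑ c, MvPolynomial.X (Sum.inl c) * MvPolynomial.C (B' c a) := by
    intro a
    simp only [Qp, map_sum, Derivation.leibniz, pd_Lp, smul_eq_mul, MvPolynomial.pderiv_X]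
    simp [Pi.single_apply]
  simp only [Db, h]
  simp only [Qp, Finset.mul_sum]
  rw [Finset.sum_comm]
  refine Finset.sum_congr rfl fun c _ => ?_
  simp only [Lf, Finset.mul_sum, Finset.sum_mul, Matrix.mul_apply, map_sum, map_mul]
  rw [Finset.sum_comm]
  refine Finset.sum_congr rfl fun b _ => Finset.sum_congr rfl fun a _ => by ring

lemma Ep_wick {N : ℕ} (B : Matrix (Fin N) (Fin N) ℂ) (P : MvPolynomial (Fin N ⊕ Fin N) ℂ) :
    Ep (Qp B * P) = B.trace * Ep P + Ep (Db B P) := by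
  have : ∀ a, Ep (MvPolynomial.X (Sum.inl a) * (Lf B a * P)) =
      B a a * Ep P + Ep (Lf B a * MvPolynomial.pderiv (Sum.inr a) P) := by
    intro a
    rw [Ep_ibp, Derivation.leibniz, pd_Lp, Ep_add, smul_eq_mul, smul_eq_mul, mul_comm P, Ep_C, add_comm]
  simp only [Qp, Finset.sum_mul, mul_assoc, Ep_sum, this, Db, Finset.sum_add_distrib, Matrix.trace,
    Matrix.diag]

/-- list of pairings -/
def ins (u : List Bool) : List (List Bool) → List (List (List Bool))
  | [] => []
  | x :: xs => ((x ++ u) :: xs) :: (ins u xs).map (fun y => x :: y)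

lemma ins_wt (u : List Bool) (us : List (List Bool)) : ∀ y ∈ ins u us,
    wt y + 2 = wt (u :: us) ∧ y.length = us.length := by
  induction us with
  | nil => simp [ins]
  | cons x xs ih =>
    intro y hy
    simp only [ins, List.mem_cons, List.mem_map] at hy
    rcases hy with rfl | ⟨y, hy, rfl⟩
    · simp [wt]; omega
    · have := ih y hy
      simp [wt] at this ⊢; omega

lemma Db_list {N : ℕ} (S : Matrix (Fin N) (Fin N) ℂ) (u : List Bool) (us : List (List Bool)) :
    Db (ev S u) ((us.map fun x => Qp (ev S x)).prod) =
      ((ins u us).map fun y => (y.map fun x => Qp (ev S x)).prod).sum := by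
  induction us with
  | nil => simp [ins, Db]
  | cons x xs ih =>
    simp only [List.map_cons, List.prod_cons, ins, Db_mul, List.sum_cons, Db_Qp, ev_append, ih,
      List.map_map, Function.comp_def]
    rw [List.sum_map_mul_left]

/-- quadratic form product -/
noncomputable def qfp {N : ℕ} (v : Fin N → ℂ) (S : Matrix (Fin N) (Fin N) ℂ) (us : List (List Bool)) : ℂ :=
  (us.map fun x => qf v (ev S x)).prod

lemma eval_qfp {N : ℕ} (v : Fin N → ℂ) (S : Matrix (Fin N) (Fin N) ℂ) (us : List (List Bool)) :
    MvPolynomial.eval (evv v) ((us.map fun x => Qp (ev S x)).prod) = qfp v S us := by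
  rw [map_list_prod, List.map_map, qfp]
  congr 2
  funext x
  exact eval_Qp _ _

lemma Ep_list {N : ℕ} (S : Matrix (Fin N) (Fin N) ℂ) (us : List (List Bool)) :
    Ep ((us.map fun x => Qp (ev S x)).prod) = ∫ v, qfp v S us ∂(Vm N) := by
  simp only [Ep, eval_qfp]

lemma wick {N : ℕ} (S : Matrix (Fin N) (Fin N) ℂ) (u : List Bool) (us : List (List Bool)) :
    ∫ v, qfp v S (u :: us) ∂(Vm N) = (ev S u).trace * ∫ v, qfp v S us ∂(Vm N) +
      ((ins u us).map fun y => ∫ v, qfp v S y ∂(Vm N)).sum := by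
  rw [← Ep_list, List.map_cons, List.prod_cons, Ep_wick, Ep_list, Db_list]
  congr 1
  generalize ins u us = l
  induction l with
  | nil => simp [Ep_zero]
  | cons y l ih => simp only [List.map_cons, List.sum_cons, Ep_add, ih, Ep_list]

/-- trace product -/
noncomputable def trp {N : ℕ} (S : Matrix (Fin N) (Fin N) ℂ) (us : List (List Bool)) : ℂ :=
  (us.map fun x => (ev S x).trace).prod

/-- mixed integrand -/
noncomputable def Hf {N : ℕ} (us zs ws : List (List Bool)) (p : (Fin N → ℂ) × (Fin N → Fin N → ℂ)) : ℂ :=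
  qfp p.1 (Matrix.of p.2) us * trp (Matrix.of p.2) zs * trp (Matrix.of (asm p.1 p.2)) ws

/-- mixed moment -/
noncomputable def Hm (us zs ws : List (List Bool)) (N : ℕ) : ℂ :=
  ∫ p, Hf us zs ws p ∂((Vm N).prod (Qm N))

/-- trace moment -/
noncomputable def Fm (ws : List (List Bool)) (N : ℕ) : ℂ :=
  ∫ S, trp (Matrix.of S) ws ∂(Qm N)

lemma Hf_all {N : ℕ} (us zs ws : List (List Bool)) :
    AllLp (fun p => Hf us zs ws p) ((Vm N).prod (Qm N)) := by
  have h1 : ∀ i j, AllLp (fun p : (Fin N → ℂ) × (Fin N → Fin N → ℂ) => Matrix.of p.2 i j)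
      ((Vm N).prod (Qm N)) := fun i j => (Qm_coord i j).comp measurePreserving_snd
  have h2 : ∀ i, AllLp (fun p : (Fin N → ℂ) × (Fin N → Fin N → ℂ) => p.1 i)
      ((Vm N).prod (Qm N)) := fun i => (Vm_coord i).comp measurePreserving_fst
  have h3 : ∀ i j, AllLp (fun p : (Fin N → ℂ) × (Fin N → Fin N → ℂ) => Matrix.of (asm p.1 p.2) i j)
      ((Vm N).prod (Qm N)) := fun i j => (Qm_coord i j).comp (Qm_succ N)
  refine (AllLp.mul ?_ ?_).mul ?_
  · exact AllLp.list_prod us (fun u => AllLp.qf h2 h1 u)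
  · exact AllLp.list_prod zs (fun u => AllLp.tr h1 u)
  · exact AllLp.list_prod ws (fun u => AllLp.tr h3 u)

lemma Hm_nil (zs : List (List Bool)) (N : ℕ) : Hm [] zs [] N = Fm zs N := by
  unfold Hm Fm Hf
  simp only [qfp, List.map_nil, List.prod_nil, one_mul, trp, mul_one]
  have := (measurePreserving_snd (μ := Vm N) (ν := Qm N)).map_eq
  have hS : AllLp (fun S : Fin N → Fin N → ℂ => trp (Matrix.of S) zs) (Qm N) :=
    AllLp.list_prod zs (fun u => AllLp.tr (fun i j => Qm_coord i j) u)
  conv_rhs => rw [← this]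
  rw [integral_map measurable_snd.aemeasurable (by rw [this]; exact (hS 1 (by simp)).1)]

lemma Hm_succ (ws : List (List Bool)) (N : ℕ) : Hm [] [] ws N = Fm ws (N+1) := by
  unfold Hm Fm Hf
  simp only [qfp, List.map_nil, List.prod_nil, one_mul, trp]
  have := (Qm_succ N).map_eq
  have hS : AllLp (fun S : Fin (N+1) → Fin (N+1) → ℂ => trp (Matrix.of S) ws) (Qm (N+1)) :=
    AllLp.list_prod ws (fun u => AllLp.tr (fun i j => Qm_coord i j) u)
  conv_rhs => rw [← this]
  rw [integral_map (Qm_succ N).measurable.aemeasurable (by rw [this]; exact (hS 1 (by simp)).1)]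

lemma Hm_exp (us zs : List (List Bool)) (w : List Bool) (ws : List (List Bool)) (E : WExp w) (N : ℕ) :
    Hm us zs (w :: ws) N = Hm us (w :: zs) ws N +
      (letI := E.fi; ∑ i, Hm (E.us i ++ us) zs ws N) := by
  letI := E.fi
  unfold Hm
  rw [← integral_finsetSum _ (fun i _ => (Hf_all _ _ _).integrable), ← integral_add
    (Hf_all _ _ _).integrable (integrable_finsetSum _ (fun i _ => (Hf_all _ _ _).integrable))]
  congr 1
  funext p
  simp only [Hf, trp, qfp, List.map_cons, List.prod_cons, List.map_append, List.prod_append]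
  rw [E.tr_eq N p.1 p.2, add_mul, mul_add, Finset.sum_mul, Finset.mul_sum]
  have hof : (Matrix.of p.2 : Matrix (Fin N) (Fin N) ℂ) = p.2 := rfl
  congr 1
  · rw [hof]; ring
  · refine Finset.sum_congr rfl fun i _ => ?_
    rw [hof]; ring

lemma Hm_iter (us zs : List (List Bool)) (N : ℕ) :
    Hm us zs [] N = ∫ S, (∫ v, qfp v (Matrix.of S) us ∂(Vm N)) * trp (Matrix.of S) zs ∂(Qm N) := by
  unfold Hm
  rw [integral_prod_symm _ (Hf_all _ _ _).integrable]
  congr 1; funext S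
  simp only [Hf, trp, List.map_nil, List.prod_nil, mul_one]
  rw [integral_mul_const]

lemma iter_int (us zs : List (List Bool)) (N : ℕ) :
    Integrable (fun S => (∫ v, qfp v (Matrix.of S) us ∂(Vm N)) * trp (Matrix.of S) zs) (Qm N) := by
  have := (Hf_all (N := N) us zs []).integrable.integral_prod_right
  refine this.congr (Filter.Eventually.of_forall fun S => ?_)
  simp only [Hf, trp, List.map_nil, List.prod_nil, mul_one]
  rw [integral_mul_const]

lemma Hm_wick (u : List Bool) (us zs : List (List Bool)) (N : ℕ) :
    Hm (u :: us) zs [] N = Hm us (u :: zs) [] N + ((ins u us).map fun y => Hm y zs [] N).sum := by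
  simp only [Hm_iter, wick, add_mul]
  have key : ∀ l : List (List (List Bool)),
    Integrable (fun S => (l.map fun y => ∫ v, qfp v (Matrix.of S) y ∂(Vm N)).sum * trp (Matrix.of S) zs) (Qm N) ∧
    ∫ S, (l.map fun y => ∫ v, qfp v (Matrix.of S) y ∂(Vm N)).sum * trp (Matrix.of S) zs ∂(Qm N) =
     (l.map fun y => ∫ S, (∫ v, qfp v (Matrix.of S) y ∂(Vm N)) * trp (Matrix.of S) zs ∂(Qm N)).sum := by
    intro l
    induction l with
    | nil => simp
    | cons y l ih =>
      simp only [List.map_cons, List.sum_cons, add_mul]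
      exact ⟨(iter_int y zs N).add ih.1, by rw [integral_add (iter_int y zs N) ih.1, ih.2]⟩
  have e : ∀ S : Fin N → Fin N → ℂ, (ev (Matrix.of S) u).trace * (∫ v, qfp v (Matrix.of S) us ∂(Vm N)) *
      trp (Matrix.of S) zs = (∫ v, qfp v (Matrix.of S) us ∂(Vm N)) * trp (Matrix.of S) (u :: zs) := by
    intro S; simp only [trp, List.map_cons, List.prod_cons]; ring
  simp only [e]
  rw [integral_add (iter_int us (u :: zs) N) (key _).1, (key _).2]

lemma Fm_perm {zs ws : List (List Bool)} (h : zs.Perm ws) (N : ℕ) : Fm zs N = Fm ws N := by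
  unfold Fm trp
  congr 1; funext S
  exact (h.map _).prod_eq

/-- root -/
noncomputable def sqN (N : ℕ) : ℂ := ((√(N:ℝ) : ℝ) : ℂ)

/-- limits after normalisation -/
def IsLim (f : ℕ → ℂ) (d : ℕ) (c : ℂ) : Prop :=
  Filter.Tendsto (fun N => f N / sqN N ^ d) Filter.atTop (nhds c)

lemma sq_two (N : ℕ) : sqN N ^ 2 = N := by
  unfold sqN
  rw [← Complex.ofReal_pow, Real.sq_sqrt (by positivity)]; simp

lemma IsLim.add {f g : ℕ → ℂ} {d : ℕ} {a b : ℂ} (hf : IsLim f d a) (hg : IsLim g d b) :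
    IsLim (fun N => f N + g N) d (a + b) := by
  unfold IsLim at *
  simpa [add_div] using hf.add hg

lemma IsLim.lower {f : ℕ → ℂ} {d : ℕ} {a : ℂ} (hf : IsLim f d a) : IsLim f (d+2) 0 := by
  unfold IsLim at *
  have h : Filter.Tendsto (fun N : ℕ => ((N : ℂ))⁻¹) Filter.atTop (nhds 0) :=
    tendsto_inv_atTop_nhds_zero_nat
  have := hf.mul h
  rw [mul_zero] at this
  refine this.congr fun N => ?_
  rw [pow_add, sq_two, div_mul_eq_div_div, div_eq_mul_inv (f N / sqN N ^ d)]

lemma IsLim.sum {ι : Type*} (s : Finset ι) {f : ι → ℕ → ℂ} {d : ℕ} {a : ι → ℂ}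
    (hf : ∀ i ∈ s, IsLim (f i) d (a i)) : IsLim (fun N => ∑ i ∈ s, f i N) d (∑ i ∈ s, a i) := by
  unfold IsLim at *
  simpa [Finset.sum_div] using tendsto_finsetSum s hf

lemma IsLim.list {ι : Type*} (s : List ι) {f : ι → ℕ → ℂ} {d : ℕ}
    (hf : ∀ i ∈ s, IsLim (f i) d 0) : IsLim (fun N => (s.map fun i => f i N).sum) d 0 := by
  induction s with
  | nil => simp [IsLim]
  | cons a s ih =>
    simp only [List.map_cons, List.sum_cons]
    simpa using (hf a (by simp)).add (ih fun i hi => hf i (by simp [hi]))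

/-- products of limits -/
noncomputable def mp (Mw : List Bool → ℂ) (us : List (List Bool)) : ℂ := (us.map Mw).prod

lemma mp_cons (Mw : List Bool → ℂ) (u) (us : List (List Bool)) : mp Mw (u :: us) = Mw u * mp Mw us := by
  simp [mp]
lemma mp_append (Mw : List Bool → ℂ) (u us : List (List Bool)) : mp Mw (u ++ us) = mp Mw u * mp Mw us := by
  simp [mp]
lemma mp_nil (Mw : List Bool → ℂ) : mp Mw [] = 1 := by simp [mp]
lemma wt_cons (u) (us : List (List Bool)) : wt (u :: us) = u.length + 2 + wt us := by
  simp [wt]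
lemma wt_append (u us : List (List Bool)) : wt (u ++ us) = wt u + wt us := by
  simp [wt]
lemma wt_nil : wt [] = 0 := by simp [wt]

/-- induction hypothesis -/
def IH (Mw : List Bool → ℂ) (D : ℕ) : Prop := ∀ ws, wt ws < D → IsLim (Fm ws) (wt ws) (mp Mw ws)

lemma lemA {Mw : List Bool → ℂ} {D : ℕ} (h : IH Mw D) (n : ℕ) : ∀ us zs, us.length = n →
    wt us + wt zs < D → IsLim (Hm us zs []) (wt us + wt zs) (mp Mw us * mp Mw zs) := by
  induction n with
  | zero =>
    intro us zs hn hD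
    obtain rfl := List.length_eq_zero_iff.1 hn
    have e : Hm [] zs [] = Fm zs := funext fun N => Hm_nil zs N
    rw [e]
    simpa [wt_nil, mp_nil] using h zs (by omega)
  | succ n ih =>
    intro us zs hn hD
    rcases us with _ | ⟨u, us⟩
    · simp at hn
    have e : Hm (u :: us) zs [] = fun N => Hm us (u :: zs) [] N + ((ins u us).map fun y => Hm y zs [] N).sum :=
      funext fun N => Hm_wick u us zs N
    rw [e]
    have hl : us.length = n := by simpa using hn
    rw [wt_cons] at hD ⊢
    have h1 := ih us (u :: zs) hl (by rw [wt_cons]; omega)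
    have h2 : IsLim (fun N => ((ins u us).map fun y => Hm y zs [] N).sum)
        (u.length + 2 + wt us + wt zs) 0 := by
      refine IsLim.list _ fun y hy => ?_
      have hw := ins_wt u us y hy
      rw [wt_cons] at hw
      have := (ih y zs (by omega) (by omega)).lower
      convert this using 1
      omega
    have h3 : wt us + wt (u :: zs) = u.length + 2 + wt us + wt zs := by rw [wt_cons]; omega
    rw [h3] at h1
    convert h1.add h2 using 1
    simp only [mp_cons]; ring

lemma claim1 {Mw : List Bool → ℂ} {D : ℕ} (h : IH Mw D) (ws) : ∀ us zs,
    wt us + wt zs + wt ws < D →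
    IsLim (Hm us zs ws) (wt us + wt zs + wt ws) (mp Mw us * mp Mw zs * mp Mw ws) := by
  induction ws with
  | nil =>
    intro us zs hD
    simpa [wt_nil, mp_nil] using lemA h _ us zs rfl (by rw [wt_nil] at hD; omega)
  | cons w ws ih =>
    intro us zs hD
    obtain ⟨E⟩ := exp_all w
    letI := E.fi
    have e : Hm us zs (w :: ws) = fun N => Hm us (w :: zs) ws N + ∑ i, Hm (E.us i ++ us) zs ws N :=
      funext fun N => Hm_exp us zs w ws E N
    rw [e]
    rw [wt_cons] at hD ⊢
    have h1 := ih us (w :: zs) (by rw [wt_cons]; omega)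
    have h2 : IsLim (fun N => ∑ i, Hm (E.us i ++ us) zs ws N)
        (wt us + wt zs + (w.length + 2 + wt ws)) (∑ i : E.ι, 0) := by
      refine IsLim.sum _ fun i _ => ?_
      have hw := E.wt_eq i
      have := (ih (E.us i ++ us) zs (by rw [wt_append]; omega)).lower
      convert this using 1
      rw [wt_append]; omega
    have h3 : wt us + wt (w :: zs) + wt ws = wt us + wt zs + (w.length + 2 + wt ws) := by
      rw [wt_cons]; omega
    rw [h3] at h1
    convert h1.add h2 using 1
    simp only [mp_cons, Finset.sum_const_zero]; ring

/-- expansion sum -/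
noncomputable def Rw (Mw : List Bool → ℂ) {w : List Bool} (E : WExp w) : ℂ :=
  letI := E.fi; ∑ i, mp Mw (E.us i)

/-- derivative sum -/
noncomputable def rr (Mw : List Bool → ℂ) (EX : ∀ w, WExp w) : List (List Bool) → ℂ
  | [] => 0
  | w :: ws => Rw Mw (EX w) * mp Mw ws + Mw w * rr Mw EX ws

lemma claim2 {Mw : List Bool → ℂ} {D : ℕ} (h : IH Mw D) (EX : ∀ w, WExp w) (d : ℕ) (hd : d < D) (ws) :
    ∀ zs, wt zs + wt ws = d + 2 →
    IsLim (fun N => Hm [] zs ws N - Fm (zs ++ ws) N) d (mp Mw zs * rr Mw EX ws) := by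
  induction ws with
  | nil =>
    intro zs hD
    simp [Hm_nil, rr, IsLim]
  | cons w ws ih =>
    intro zs hD
    letI := (EX w).fi
    have e : (fun N => Hm [] zs (w :: ws) N - Fm (zs ++ w :: ws) N) =
        fun N => (Hm [] (w :: zs) ws N - Fm (w :: zs ++ ws) N) + ∑ i, Hm ((EX w).us i) zs ws N := by
      funext N
      rw [Hm_exp [] zs w ws (EX w) N, Fm_perm (List.perm_middle (l₁ := zs)) N]
      simp only [List.append_nil, List.cons_append]
      ring
    rw [e]
    have h1 := ih (w :: zs) (by rw [wt_cons] at hD ⊢; omega)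
    have h2 : IsLim (fun N => ∑ i, Hm ((EX w).us i) zs ws N) d
        (∑ i, mp Mw ((EX w).us i) * mp Mw zs * mp Mw ws) := by
      refine IsLim.sum _ fun i _ => ?_
      have hw := (EX w).wt_eq i
      rw [wt_cons] at hD
      have := (claim1 h ws ((EX w).us i) zs (by omega))
      convert this using 1
      omega
    convert h1.add h2 using 1
    simp only [mp_cons, rr, Rw, ← Finset.sum_mul]; ring

lemma sqrt_diff (p : ℕ) : Filter.Tendsto (fun N : ℕ => (√((N+1:ℕ):ℝ) ^ (p+2) - √(N:ℝ) ^ (p+2)) / √(N:ℝ) ^ p)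
    Filter.atTop (nhds (((p:ℝ)+2)/2)) := by
  have hd : HasDerivAt (fun t : ℝ => √(1+t) ^ (p+2)) (((p:ℝ)+2)/2) 0 := by
    have h1 : HasDerivAt (fun t : ℝ => 1 + t) 1 0 := by simpa using (hasDerivAt_id (0:ℝ)).const_add 1
    have h2 := (h1.sqrt (by norm_num)).pow (p+2)
    refine HasDerivAt.congr_deriv h2 ?_
    simp
    ring
  have h3 := hd.tendsto_slope_zero_right
  have h4 : Filter.Tendsto (fun N : ℕ => ((N:ℝ))⁻¹) Filter.atTop (nhdsWithin 0 (Set.Ioi 0)) := by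
    refine tendsto_inv_atTop_nhdsGT_zero.comp tendsto_natCast_atTop_atTop
  refine (h3.comp h4).congr' ?_
  filter_upwards [Filter.eventually_ge_atTop 1] with N hN
  have hN' : (0:ℝ) < N := by exact_mod_cast hN
  have hs : (0:ℝ) < √(N:ℝ) := Real.sqrt_pos.2 hN'
  have e1 : ((N+1:ℕ):ℝ) = N * (1 + (N:ℝ)⁻¹) := by push_cast; field_simp
  have e2 : √(N:ℝ) ^ 2 = N := Real.sq_sqrt hN'.le
  simp only [Function.comp_apply, smul_eq_mul, inv_inv, zero_add, add_zero, Real.sqrt_one, one_pow]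
  rw [e1, Real.sqrt_mul hN'.le, mul_pow, pow_add (√(N:ℝ)) p 2, e2]
  field_simp

lemma stolz (a : ℕ → ℂ) (d : ℕ) (c : ℂ) (h : IsLim (fun N => a (N+1) - a N) d c) :
    IsLim a (d+2) (2 / ((d:ℂ)+2) * c) := by
  set b : ℕ → ℝ := fun N => √(N:ℝ) ^ (d+2) with hb
  set g : ℕ → ℝ := fun N => b (N+1) - b N with hg
  set κ : ℂ := 2 / ((d:ℂ)+2) * c with hκ
  have hd2 : ((d:ℂ)+2) ≠ 0 := by exact_mod_cast (by omega : d + 2 ≠ 0)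
  have hgl : Filter.Tendsto (fun N => g N / √(N:ℝ)^d) Filter.atTop (nhds (((d:ℝ)+2)/2)) := sqrt_diff d
  have hglC : IsLim (fun N => (g N : ℂ)) d (((d:ℂ)+2)/2) := by
    have := (Complex.continuous_ofReal.tendsto _).comp hgl
    unfold IsLim sqN
    convert this using 1
    · funext N; simp
    · simp
  have he : Filter.Tendsto (fun N => (a (N+1) - a N - κ * g N) / sqN N ^ d) Filter.atTop (nhds 0) := by
    have := Filter.Tendsto.sub h (Filter.Tendsto.const_mul κ hglC)
    convert this using 1
    · funext N; ring
    · rw [hκ]; field_simp; simp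
  have hsq : ∀ᶠ N : ℕ in Filter.atTop, 0 < √(N:ℝ) := by
    filter_upwards [Filter.eventually_ge_atTop 1] with N hN
    exact Real.sqrt_pos.2 (by exact_mod_cast hN)
  have ho1 : (fun N => a (N+1) - a N - κ * g N) =o[Filter.atTop] (fun N : ℕ => √(N:ℝ) ^ d) := by
    have : (fun N => a (N+1) - a N - κ * g N) =o[Filter.atTop] (fun N : ℕ => sqN N ^ d) := by
      refine (Asymptotics.isLittleO_iff_tendsto' ?_).2 he
      filter_upwards [hsq] with N hN h0
      exfalso
      have : sqN N ≠ 0 := by unfold sqN; exact_mod_cast hN.ne'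
      exact pow_ne_zero d this h0
    refine this.trans_isBigO (Asymptotics.IsBigO.of_bound 1 (Filter.Eventually.of_forall fun N => ?_))
    simp [sqN]
  have ho2 : (fun N : ℕ => √(N:ℝ) ^ d) =O[Filter.atTop] g := by
    have hinv := hgl.inv₀ (by positivity)
    refine (Asymptotics.isBigO_of_div_tendsto_nhds ?_ _ (hinv.congr fun N => by simp))
    have hpos : ∀ᶠ N in Filter.atTop, 0 < g N / √(N:ℝ)^d := hgl.eventually (lt_mem_nhds (by positivity))
    filter_upwards [hpos] with N h1 h2
    rw [h2] at h1; simp at h1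
  have hg0 : 0 ≤ g := by
    intro N
    simp only [hg, hb, Pi.zero_apply, sub_nonneg]
    gcongr; simp
  have hsum : ∀ N, ∑ i ∈ Finset.range N, g i = b N := by
    intro N
    rw [hg, Finset.sum_range_sub b]; simp [hb]
  have hbt : Filter.Tendsto b Filter.atTop Filter.atTop := by
    refine (Filter.tendsto_pow_atTop (by omega)).comp (Real.tendsto_sqrt_atTop.comp tendsto_natCast_atTop_atTop)
  have ho3 := (ho1.trans_isBigO ho2).sum_range hg0 (by simpa only [hsum] using hbt)
  simp only [hsum, Finset.sum_sub_distrib] at ho3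
  have e3 : ∀ N, ∑ i ∈ Finset.range N, a (i+1) - ∑ i ∈ Finset.range N, a i = a N - a 0 := by
    intro N; rw [← Finset.sum_sub_distrib, Finset.sum_range_sub a]
  have e4 : ∀ N, ∑ i ∈ Finset.range N, κ * (g i : ℂ) = κ * b N := by
    intro N; rw [← Finset.mul_sum, ← hsum N]; push_cast; rfl
  simp only [e3, e4] at ho3
  have ho4 : (fun N => a N - κ * b N) =o[Filter.atTop] b := by
    have : (fun _ : ℕ => a 0) =o[Filter.atTop] b :=
      Asymptotics.isLittleO_const_left.2 (Or.inr (tendsto_norm_atTop_atTop.comp hbt))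
    refine (ho3.add this).congr_left fun N => by ring
  have ho5 : (fun N => a N - κ * b N) =o[Filter.atTop] (fun N => sqN N ^ (d+2)) := by
    refine ho4.trans_isBigO (Asymptotics.IsBigO.of_bound 1 (Filter.Eventually.of_forall fun N => ?_))
    simp [sqN, hb]
  have h6 := ho5.tendsto_div_nhds_zero.add_const κ
  rw [zero_add] at h6
  refine h6.congr' ?_
  filter_upwards [hsq] with N hN
  have : sqN N ≠ 0 := by unfold sqN; exact_mod_cast hN.ne'
  have hbN : (b N : ℂ) = sqN N ^ (d+2) := by simp [hb, sqN]
  rw [hbN]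
  field_simp
  ring

lemma IH_all {Mw : List Bool → ℂ} (hMw : ∀ w, IsLim (Fm [w]) (w.length + 2) (Mw w)) (D : ℕ) :
    IH Mw D ∧ ∀ (w : List Bool) (E : WExp w), w.length + 2 < D → Mw w = 2 / ((w.length : ℂ) + 2) * Rw Mw E := by
  induction D with
  | zero => exact ⟨fun ws h => by omega, fun w E h => by omega⟩
  | succ D ih =>
    obtain ⟨ih, -⟩ := ih
    have step : ∀ (EX : ∀ w, WExp w) (ws) (d : ℕ), d < D → wt ws = d + 2 →
        IsLim (Fm ws) (d+2) (2 / ((d:ℂ)+2) * rr Mw EX ws) := by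
      intro EX ws d hd hw
      refine stolz _ _ _ ?_
      have := claim2 ih EX d hd ws [] (by rw [wt_nil]; omega)
      simpa [Hm_succ, mp_nil] using this
    have single : ∀ (w : List Bool) (E : WExp w), w.length + 2 < D + 1 →
        Mw w = 2 / ((w.length : ℂ) + 2) * Rw Mw E := by
      intro w E hw
      let EX : ∀ w, WExp w := fun w' => if h : w' = w then h ▸ E else Classical.choice (exp_all w')
      have hE : EX w = E := by simp [EX]
      have h1 := step EX [w] w.length (by omega) (by simp [wt])
      have h2 := tendsto_nhds_unique (hMw w) h1
      rw [h2]
      simp [rr, hE, mp_nil]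
    refine ⟨?_, single⟩
    intro ws hws
    let EX : ∀ w, WExp w := fun w' => Classical.choice (exp_all w')
    have key : ∀ ws, wt ws < D + 1 → rr Mw EX ws = (wt ws : ℂ) / 2 * mp Mw ws := by
      intro ws
      induction ws with
      | nil => simp [rr, wt]
      | cons w ws ih2 =>
        intro hw
        rw [wt_cons] at hw
        have h1 := single w (EX w) (by omega)
        have hd2 : ((w.length:ℂ)+2) ≠ 0 := by exact_mod_cast (by omega : w.length + 2 ≠ 0)
        have h3 : Rw Mw (EX w) = ((w.length:ℂ)+2)/2 * Mw w := by
          rw [h1]; field_simp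
        simp only [rr, ih2 (by omega), h3, mp_cons, wt_cons]
        push_cast; ring
    rcases ws with _ | ⟨w, ws⟩
    · simp [IsLim, wt_nil, mp_nil, Fm, trp]
    · obtain ⟨d, hd⟩ : ∃ d, wt (w :: ws) = d + 2 := ⟨w.length + wt ws, by rw [wt_cons]; omega⟩
      have h1 := step EX (w :: ws) d (by omega) hd
      rw [key _ hws] at h1
      rw [hd] at h1 ⊢
      convert h1 using 1
      have hd2 : ((d:ℂ)+2) ≠ 0 := by exact_mod_cast (by omega : d + 2 ≠ 0)
      push_cast; field_simp

lemma Mw_rec {Mw : List Bool → ℂ} (hMw : ∀ w, IsLim (Fm [w]) (w.length + 2) (Mw w))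
    (w : List Bool) (E : WExp w) : Mw w = 2 / ((w.length : ℂ) + 2) * Rw Mw E :=
  (IH_all hMw (w.length + 3)).2 w E (by omega)

/-- word of an exponent list -/
def wo : List ℕ → List Bool
  | [] => []
  | [a] => List.replicate a false
  | a :: b :: r => List.replicate a false ++ (List.replicate b true ++ wo r)

lemma altWord_ev {N : ℕ} (S : Matrix (Fin N) (Fin N) ℂ) (e : List ℕ) : altWord Sᴴ S e = ev S (wo e) := by
  induction e using wo.induct with
  | case1 => simp [altWord, wo, ev_nil]
  | case2 a => simp [altWord, wo, ev_repF]
  | case3 a b r ih => simp [altWord, wo, ev_append, ev_repF, ev_repT, ih, mul_assoc]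

lemma wo_pairs {α : Type*} (k l : α → ℕ) (xs : List α) (r : List ℕ) :
    wo ((xs.flatMap fun i => [k i, l i]) ++ r) =
      (xs.flatMap fun i => List.replicate (k i) false ++ List.replicate (l i) true) ++ wo r := by
  induction xs with
  | nil => simp
  | cons a xs ih => simp [wo, ih]

lemma wo_seg {α : Type*} (k l : α → ℕ) (xs : List α) (x y : ℕ) :
    wo ([x] ++ (xs.flatMap fun i => [k i, l i]) ++ [y]) =
      (List.replicate x true ++ ((xs.flatMap fun i => List.replicate (k i) false ++ List.replicate (l i) true)
        ++ List.replicate y false)).map not := by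
  induction xs generalizing x with
  | nil => simp [wo]
  | cons a xs ih =>
    have := ih (l a)
    simp only [List.cons_append, List.nil_append] at this
    simp [wo, this]

/-- exponents of a word -/
def toExp (w : List Bool) : List ℕ := 0 :: 0 :: w.flatMap fun b => cond b [0,1] [1,0]

lemma wo_toExp (w : List Bool) : wo (toExp w) = w := by
  unfold toExp
  simp only [wo, List.replicate_zero, List.nil_append]
  induction w with
  | nil => simp [wo]
  | cons b w ih => cases b <;> simp [wo, ih]

lemma toExp_len (w : List Bool) : (toExp w).length % 2 = 0 := by
  unfold toExp
  induction w with
  | nil => simp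
  | cons b w ih => cases b <;> simp at ih ⊢ <;> omega

lemma ev_cont {N : ℕ} (w : List Bool) : Continuous (fun t : Fin N → Fin N → ℂ => ev (Matrix.of t) w) := by
  have h : Continuous (fun t : Fin N → Fin N → ℂ => (Matrix.of t : Matrix (Fin N) (Fin N) ℂ)) := continuous_id
  induction w with
  | nil => simpa [ev_nil] using continuous_const
  | cons b w ih =>
    have e : ∀ t : Fin N → Fin N → ℂ, ev (Matrix.of t) (b :: w) =
      (cond b (Matrix.of t) (Matrix.of t)ᴴ) * ev (Matrix.of t) w := fun t => by simp [ev]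
    simp only [e]
    cases b
    · exact h.matrix_conjTranspose.matrix_mul ih
    · exact h.matrix_mul ih

lemma ev_smul {N : ℕ} (c : ℝ) (S : Matrix (Fin N) (Fin N) ℂ) (w : List Bool) :
    ev ((c : ℂ) • S) w = (c : ℂ) ^ w.length • ev S w := by
  induction w with
  | nil => simp [ev_nil]
  | cons b w ih =>
    have e : ∀ S : Matrix (Fin N) (Fin N) ℂ, ev S (b :: w) = (cond b S Sᴴ) * ev S w := fun S => by simp [ev]
    rw [e, e, ih]
    cases b
    · simp only [cond_false, Matrix.conjTranspose_smul, Matrix.smul_mul, Matrix.mul_smul, smul_smul,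
        List.length_cons, pow_succ, RCLike.star_def, Complex.conj_ofReal]
    · simp only [cond_true, Matrix.smul_mul, Matrix.mul_smul, smul_smul, List.length_cons, pow_succ]

lemma GT_int (e : List ℕ) (N : ℕ) (hN : 1 ≤ N) :
    ∫ t : Fin N → Fin N → ℂ, (N : ℂ)⁻¹ * (altWord (Matrix.of t)ᴴ (Matrix.of t) e).trace ∂(GTlaw N) =
      Fm [wo e] N / sqN N ^ ((wo e).length + 2) := by
  simp only [altWord_ev]
  have hm := GT_scale N hN
  rw [← hm.map_eq, integral_map hm.measurable.aemeasurable]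
  · rw [integral_const_mul]
    have h1 : ∀ S : Fin N → Fin N → ℂ,
        (ev (Matrix.of (fun i j => ((√(N:ℝ) : ℝ) : ℂ)⁻¹ * S i j)) (wo e)).trace =
        ((sqN N)⁻¹) ^ (wo e).length * trp (Matrix.of S) [wo e] := by
      intro S
      have : (Matrix.of (fun i j => ((√(N:ℝ) : ℝ) : ℂ)⁻¹ * S i j) : Matrix (Fin N) (Fin N) ℂ) =
          (((√(N:ℝ))⁻¹ : ℝ) : ℂ) • Matrix.of S := by
        ext i j; simp
      rw [this, ev_smul, Matrix.trace_smul]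
      simp [trp, sqN]
    simp only [h1]
    rw [integral_const_mul, Fm, pow_add, sq_two, inv_pow, div_eq_mul_inv, mul_inv]
    ring
  · have : Continuous (fun t : Fin N → Fin N → ℂ => (N : ℂ)⁻¹ * (ev (Matrix.of t) (wo e)).trace) :=
      continuous_const.mul (ev_cont _).matrix_trace
    exact this.aestronglyMeasurable

lemma Fm_rot (x y : List Bool) : Fm [x ++ y] = Fm [y ++ x] := by
  funext N
  simp [Fm, trp, trace_ev_comm _ x y]

lemma ev_flip {N : ℕ} (S : Matrix (Fin N) (Fin N) ℂ) (w : List Bool) :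
    ev (Sᴴ.submatrix Fin.revPerm Fin.revPerm) w = (ev S (w.map not)).submatrix Fin.revPerm Fin.revPerm := by
  induction w with
  | nil => simp [ev_nil]
  | cons b w ih =>
    have e : ∀ (S : Matrix (Fin N) (Fin N) ℂ) b w, ev S (b :: w) = (cond b S Sᴴ) * ev S w :=
      fun S b w => by simp [ev]
    rw [List.map_cons, e, e, ih]
    rw [← Matrix.submatrix_mul_equiv _ _ _ Fin.revPerm]
    cases b <;> simp [Matrix.conjTranspose_submatrix]

lemma Fm_flip (w : List Bool) : Fm [w.map not] = Fm [w] := by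
  funext N
  unfold Fm
  have hm := Qm_flip N
  conv_rhs => rw [← hm.map_eq]
  rw [integral_map hm.measurable.aemeasurable]
  · congr 1; funext S
    have h1 : (Matrix.of (fun i j => star (S j.rev i.rev)) : Matrix (Fin N) (Fin N) ℂ) =
      (Matrix.of S)ᴴ.submatrix Fin.revPerm Fin.revPerm := by ext i j; simp
    simp only [trp, List.map_cons, List.map_nil, List.prod_cons, List.prod_nil, mul_one]
    rw [h1, ev_flip]
    exact (Equiv.sum_comp Fin.revPerm (fun i => ev (Matrix.of S) (w.map not) i i)).symm
  · have : Continuous (fun t : Fin N → Fin N → ℂ => trp (Matrix.of t) [w]) := by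
      simpa [trp] using (ev_cont w).matrix_trace
    exact this.aestronglyMeasurable

lemma filt_range (n a b : ℕ) (hab : a ≤ b) (hb : b ≤ n) :
    (List.range n).filter (fun i => decide (a ≤ i ∧ i < b)) = List.range' a (b - a) := by
  have e : List.range n = List.range' 0 a ++ (List.range' a (b-a) ++ List.range' b (n-b)) := by
    rw [List.range_eq_range']
    have h1 := @List.range'_append a (b-a) (n-b) 1
    have h2 := @List.range'_append 0 a (b-a+(n-b)) 1
    simp only [one_mul, zero_add] at h1 h2
    rw [show a + (b-a) = b by omega] at h1
    rw [h1, h2]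
    congr 1; omega
  rw [e, List.filter_append, List.filter_append]
  rw [List.filter_eq_nil_iff.2, List.filter_eq_self.2, List.filter_eq_nil_iff.2]
  · simp
  · intro i hi; simp only [List.mem_range'_1] at hi; simp; omega
  · intro i hi; simp only [List.mem_range'_1] at hi; simp; omega
  · intro i hi; simp only [List.mem_range'_1] at hi; simp; omega

lemma filt_fin (n a b : ℕ) (hab : a ≤ b) (hb : b ≤ n) (p : Fin n → Bool)
    (hp : ∀ i, p i = decide (a ≤ (i:ℕ) ∧ (i:ℕ) < b)) (K L : ℕ → ℕ) (k l : Fin n → ℕ)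
    (hk : ∀ i, k i = K i) (hl : ∀ i, l i = L i) :
    (((List.finRange n).filter p).flatMap fun i => List.replicate (k i) false ++ List.replicate (l i) true)
      = bw K L a b := by
  have e1 : ((List.finRange n).filter p).map (fun i : Fin n => (i : ℕ)) = List.range' a (b - a) := by
    rw [← filt_range n a b hab hb, ← List.map_coe_finRange_eq_range, List.filter_map]
    congr 2
    funext i; rw [hp]; rfl
  rw [bw, ← e1, List.flatMap_map]
  simp only [hk, hl]
  rfl

theorem stmt17_aux (M : List ℕ → ℂ)
    (hM : ∀ e : List ℕ, e ≠ [] → e.length % 2 = 0 →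
      Filter.Tendsto
        (fun N : ℕ =>
          ∫ t : Fin N → Fin N → ℂ,
            (N : ℂ)⁻¹ * (altWord (Matrix.of t)ᴴ (Matrix.of t) e).trace ∂(GTlaw N))
        Filter.atTop (nhds (M e)))
    (n : ℕ) (hn : 1 ≤ n) (k l : Fin n → ℕ) (hk : ∀ i, 1 ≤ k i) (hl : ∀ i, 1 ≤ l i)
    (m : ℕ) (hmk : ∑ i, k i = m) (hml : ∑ i, l i = m) :
    M (blocksList n k l) = ((m : ℂ) + 1)⁻¹ *
      ∑ r : Fin n, ∑ j : Fin ((r : ℕ) + 1) → Fin n,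
        if StrictMono j then
          M (outerList n k l (j 0) (j (Fin.last r))) *
            ∏ i : Fin (r : ℕ),
              M (segmentList n k l (j i.castSucc) (j i.succ))
        else 0 := by
  have hL : ∀ e : List ℕ, e ≠ [] → e.length % 2 = 0 →
      IsLim (Fm [wo e]) ((wo e).length + 2) (M e) := by
    intro e h1 h2
    refine (hM e h1 h2).congr' ?_
    filter_upwards [Filter.eventually_ge_atTop 1] with N hN
    exact GT_int e N hN
  obtain ⟨Mw, hMw0⟩ : ∃ Mw : List Bool → ℂ, Mw = fun w => M (toExp w) := ⟨_, rfl⟩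
  have hMw : ∀ w, IsLim (Fm [w]) (w.length + 2) (Mw w) := by
    intro w
    have := hL (toExp w) (by simp [toExp]) (toExp_len w)
    rw [wo_toExp] at this
    rw [hMw0]; exact this
  have hME : ∀ e : List ℕ, e ≠ [] → e.length % 2 = 0 → M e = Mw (wo e) := fun e h1 h2 =>
    tendsto_nhds_unique (hL e h1 h2) (hMw _)
  have hrot : ∀ x y, Mw (x ++ y) = Mw (y ++ x) := by
    intro x y
    have h1 := hMw (x ++ y)
    have h2 := hMw (y ++ x)
    rw [Fm_rot, List.length_append, add_comm x.length, ← List.length_append] at h1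
    exact tendsto_nhds_unique h1 h2
  have hflip : ∀ x, Mw (x.map not) = Mw x := by
    intro x
    have h1 := hMw (x.map not)
    rw [Fm_flip, List.length_map] at h1
    exact tendsto_nhds_unique h1 (hMw x)
  obtain ⟨K, hK⟩ : ∃ K : ℕ → ℕ, K = fun i => if h : i < n then k ⟨i, h⟩ else 1 := ⟨_, rfl⟩
  obtain ⟨L, hLL⟩ : ∃ K : ℕ → ℕ, K = fun i => if h : i < n then l ⟨i, h⟩ else 1 := ⟨_, rfl⟩
  have hkK : ∀ i : Fin n, k i = K i := by intro i; simp [hK]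
  have hlL : ∀ i : Fin n, l i = L i := by intro i; simp [hLL]
  have hK1 : ∀ i, 1 ≤ K i := by intro i; simp only [hK]; split_ifs <;> simp [hk]
  have hL1 : ∀ i, 1 ≤ L i := by intro i; simp only [hLL]; split_ifs <;> simp [hl]
  have hpl : ∀ xs : List (Fin n), (xs.flatMap fun i => [k i, l i]).length % 2 = 0 := by
    intro xs
    induction xs with
    | nil => simp
    | cons a xs ih => simp at ih ⊢; omega
  have hblocks : M (blocksList n k l) = Mw (bw K L 0 n) := by
    have e : blocksList n k l = (((List.finRange n).filter fun _ => true).flatMap fun i => [k i, l i]) ++ [] := by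
      simp [blocksList, List.ofFn_eq_map, List.flatMap]
    rw [hME, e, wo_pairs, filt_fin n 0 n (by omega) le_rfl _ (by simp) K L k l hkK hlL]
    · simp [wo]
    · rw [e]; intro h
      have := congrArg List.length h
      simp at this
      omega
    · rw [e, List.append_nil]; exact hpl _
  have houter : ∀ a b : Fin n, M (outerList n k l a b) = Mw (outerW K L n a b) := by
    intro a b
    have e : wo (outerList n k l a b) = (bw K L 0 a ++ List.replicate (K a - 1) false) ++
        (List.replicate (L b - 1) true ++ bw K L (b+1) n) := by
      rw [outerList, List.append_assoc, wo_pairs, filt_fin n 0 a (by omega) a.2.le _ (fun i => by rw [Bool.eq_iff_iff]; simp only [decide_eq_true_eq, Fin.lt_def]; omega) K L k l hkK hlL]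
      have := wo_pairs k l ((List.finRange n).filter fun i => decide (b < i)) []
      rw [List.append_nil, filt_fin n (b+1) n (by omega) le_rfl _ (fun i => by rw [Bool.eq_iff_iff]; simp only [decide_eq_true_eq, Fin.lt_def]; omega) K L k l hkK hlL] at this
      rw [List.cons_append, List.cons_append, List.nil_append, wo, this, hkK a, hlL b]
      simp [wo]
    rw [hME, e, hrot, outerW, List.append_assoc]
    · simp [outerList]
    · have h1 := hpl ((List.finRange n).filter fun i => decide (i < a))
      have h2 := hpl ((List.finRange n).filter fun i => decide (b < i))
      simp only [outerList, List.length_append, List.length_cons, List.length_nil]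
      omega
  have hseg : ∀ a b : Fin n, a < b → M (segmentList n k l a b) = Mw (segW K L a b) := by
    intro a b hab
    rw [hME, segmentList, wo_seg, filt_fin n (a+1) b hab b.2.le _ (fun i => by rw [Bool.eq_iff_iff]; simp only [decide_eq_true_eq, Fin.lt_def]; omega) K L k l hkK hlL,
      hflip, segW, hkK, hlL]
    · simp [segmentList]
    · have h1 := hpl ((List.finRange n).filter fun i => decide (a < i ∧ i < b))
      simp only [segmentList, List.length_append, List.length_cons, List.length_nil]
      omega
  have hlen : (bw K L 0 n).length = 2 * m := by
    have h := bw_length K L 0 n (by omega)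
    rw [Finset.sum_range] at h
    have h2 : ∑ i : Fin n, ((K i : ℤ) + L i) = 2 * m := by
      simp only [← hkK, ← hlL, Finset.sum_add_distrib]
      have e1 : ((∑ i, k i : ℕ) : ℤ) = m := by rw [hmk]
      have e2 : ((∑ i, l i : ℕ) : ℤ) = m := by rw [hml]
      push_cast at e1 e2
      rw [e1, e2]; ring
    rw [h2] at h
    simp at h
    omega
  rw [hblocks, Mw_rec hMw _ (blockExp n hn K L hK1 hL1), hlen]
  have hm1 : ((m:ℂ)+1) ≠ 0 := by exact_mod_cast (by omega : m + 1 ≠ 0)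
  congr 1
  · push_cast
    rw [show (2:ℂ) * m + 2 = 2 * (m+1) by ring, div_mul_eq_div_div]; simp
  · rw [← sum_chain (f := fun r j => M (outerList n k l (j 0) (j (Fin.last r))) *
            ∏ i : Fin (r : ℕ), M (segmentList n k l (j i.castSucc) (j i.succ)))]
    unfold Rw
    refine Finset.sum_congr rfl fun x _ => ?_
    simp only [blockExp, mp_cons, houter]
    congr 1
    rw [mp, List.map_ofFn, List.prod_ofFn]
    refine Finset.prod_congr rfl fun i _ => ?_
    exact (hseg _ _ (x.2.2 Fin.castSucc_lt_succ)).symm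

/-- The recursion formula for the limit `*`-moments
`M(k₁,ℓ₁,…,k_n,ℓ_n) = lim_N E[tr_N((T_N*)^{k₁} T_N^{ℓ₁} ⋯ (T_N*)^{k_n} T_N^{ℓ_n})]`
of strictly upper triangular Gaussian random matrices: if all `kᵢ, ℓᵢ ≥ 1` and
`m = Σkᵢ = Σℓᵢ`, then `M(k₁,ℓ₁,…,k_n,ℓ_n)` equals `1/(m+1)` times the sum over `r ≥ 1` and
over `j(1) < ⋯ < j(r)` of the products of `M`-values described in the paper. -/
theorem stmt17 (M : List ℕ → ℂ)
    (hM : ∀ e : List ℕ, e ≠ [] → e.length % 2 = 0 →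
      Filter.Tendsto
        (fun N : ℕ =>
          ∫ t : Fin N → Fin N → ℂ,
            (N : ℂ)⁻¹ * (altWord (Matrix.of t)ᴴ (Matrix.of t) e).trace ∂(GTlaw N))
        Filter.atTop (nhds (M e)))
    (n : ℕ) (hn : 1 ≤ n) (k l : Fin n → ℕ) (hk : ∀ i, 1 ≤ k i) (hl : ∀ i, 1 ≤ l i)
    (m : ℕ) (hmk : ∑ i, k i = m) (hml : ∑ i, l i = m) :
    M (blocksList n k l) = ((m : ℂ) + 1)⁻¹ *
      ∑ r : Fin n, ∑ j : Fin ((r : ℕ) + 1) → Fin n,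
        if StrictMono j then
          M (outerList n k l (j 0) (j (Fin.last r))) *
            ∏ i : Fin (r : ℕ),
              M (segmentList n k l (j i.castSucc) (j i.succ))
        else 0 := by
  exact stmt17_aux M hM n hn k l hk hl m hmk hml
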